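/- arXiv:math/0508245 — 3 statements merged into one kernel-verified Lean document; each statement's English description precedes it below -/
import Mathlib

section
/- Let σ be a finite nonnegative Borel measure on the unit circle 𝕋 with σ ≠ 0, and define Q₁(z) = ∫_𝕋 (ξ + z)/(ξ − z) dσ(ξ) and Q₂(z) = z·exp(Q₁(z)) for z ∈ 𝔻. Then Q₂ : 𝔻 → ℂ takes every value in 𝔻 precisely once; that is, for every w ∈ 𝔻 there is a unique z ∈ 𝔻 with Q₂(z) = w. Moreover, the inverse Q₂^{(−1)} : 𝔻 → 𝔻 thus defined belongs to the class 𝒮_*. -/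
open MeasureTheory Complex Filter Set

/-- Open unit disk. -/
def unitDisk : Set ℂ := Metric.ball 0 1

/-- The class ℳ_* of Borel probability measures on the unit circle 𝕋
with nonzero first moment. -/
def MStar (μ : Measure ℂ) : Prop :=
  IsProbabilityMeasure μ ∧ μ ((Metric.sphere (0 : ℂ) 1)ᶜ) = 0 ∧ (∫ ξ, ξ ∂μ) ≠ 0

/-- ψ_μ(z) = ∫ zξ/(1 − zξ) dμ(ξ). -/
noncomputable def psiStar (μ : Measure ℂ) (z : ℂ) : ℂ :=
  ∫ ξ, (z * ξ) / (1 - z * ξ) ∂μ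

/-- Q_μ = ψ_μ/(1 + ψ_μ). -/
noncomputable def QStar (μ : Measure ℂ) (z : ℂ) : ℂ :=
  psiStar μ z / (1 + psiStar μ z)

/-- The class 𝒮_*: Schur functions Q with Q(0) = 0 and Q′(0) ≠ 0. -/
def schurStar (Q : ℂ → ℂ) : Prop :=
  DifferentiableOn ℂ Q unitDisk ∧ (∀ z ∈ unitDisk, ‖Q z‖ ≤ 1) ∧
  Q 0 = 0 ∧ deriv Q 0 ≠ 0

noncomputable def mob (b x : ℂ) : ℂ := (x - b) / (1 - (starRingEnd ℂ) b * x)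

lemma mob_den_ne {b x : ℂ} (hb : ‖b‖ < 1) (hx : ‖x‖ < 1) : 1 - (starRingEnd ℂ) b * x ≠ 0 := by
  intro h
  have h1 : (starRingEnd ℂ) b * x = 1 := (sub_eq_zero.mp h).symm
  have h2 : ‖(starRingEnd ℂ) b * x‖ = 1 := by rw [h1]; simp
  rw [norm_mul, RCLike.norm_conj] at h2
  nlinarith [norm_nonneg b, norm_nonneg x]

lemma mob_lt {b x : ℂ} (hb : ‖b‖ < 1) (hx : ‖x‖ < 1) : ‖mob b x‖ < 1 := by
  have h0 := mob_den_ne hb hx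
  rw [mob, norm_div, div_lt_one (norm_pos_iff.mpr h0)]
  apply lt_of_pow_lt_pow_left₀ 2 (norm_nonneg _)
  have hb2 : ‖b‖ ^ 2 < 1 := by nlinarith [norm_nonneg b]
  have hx2 : ‖x‖ ^ 2 < 1 := by nlinarith [norm_nonneg x]
  rw [Complex.sq_norm, Complex.normSq_apply] at *
  rw [Complex.sq_norm, Complex.normSq_apply] at *
  simp
  nlinarith

lemma mob_diff {b x : ℂ} (hb : ‖b‖ < 1) (hx : ‖x‖ < 1) : DifferentiableAt ℂ (mob b) x := by
  unfold mob
  exact DifferentiableAt.div (by fun_prop) (by fun_prop) (mob_den_ne hb hx)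

lemma mob_inv {b x : ℂ} (hb : ‖b‖ < 1) (hx : ‖x‖ < 1) : mob (-b) (mob b x) = x := by
  have h0 := mob_den_ne hb hx
  have h1 := mob_den_ne (b := -b) (by simpa using hb) (mob_lt hb hx)
  have h2 := mob_den_ne hb hb
  rw [mob, div_eq_iff h1]
  have h3 : mob b x * (1 - (starRingEnd ℂ) b * x) = x - b := div_mul_cancel₀ _ h0
  simp only [map_neg]
  linear_combination h3

lemma schwarz_pick {G : ℂ → ℂ} (hd : DifferentiableOn ℂ G (Metric.ball 0 1))
    (hm : ∀ z, ‖z‖ < 1 → ‖G z‖ < 1) {z p : ℂ} (hz : ‖z‖ < 1) (hp : ‖p‖ < 1) :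
    ‖mob (G p) (G z)‖ ≤ ‖mob p z‖ := by
  have hp' : ‖-p‖ < 1 := by simpa using hp
  have key := Complex.norm_le_norm_of_mapsTo_ball (R := 1)
    (f := fun u => mob (G p) (G (mob (-p) u))) (z := mob p z) ?_ ?_ ?_ (mob_lt hp hz)
  · simpa only [mob_inv hp hz] using key
  · intro u hu
    rw [mem_ball_zero_iff] at hu
    have h1 := mob_lt hp' hu
    apply DifferentiableAt.differentiableWithinAt
    have hG : DifferentiableAt ℂ G (mob (-p) u) :=
      hd.differentiableAt (Metric.isOpen_ball.mem_nhds (by simpa using h1))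
    exact (mob_diff (hm p hp) (hm _ h1)).comp u (hG.comp u (mob_diff hp' hu))
  · intro u hu
    rw [mem_ball_zero_iff] at hu
    simpa using (mob_lt (hm p hp) (hm _ (mob_lt hp' hu))).le
  · simp [mob]

lemma one_sub_bound {t : ℝ} (ht0 : 0 ≤ t) (ht : t < 1) {c : ℂ} (hc : ‖c‖ ≤ 1) :
    (1 + t) * ‖1 - c‖ ≤ 2 * ‖1 - t * c‖ := by
  refine (pow_le_pow_iff_left₀ (by positivity) (by positivity) two_ne_zero).mp ?_
  rw [mul_pow, mul_pow]
  have hc2 : ‖c‖ ^ 2 ≤ 1 := by nlinarith [norm_nonneg c]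
  simp only [Complex.sq_norm, Complex.normSq_apply] at *
  simp
  set x := c.re
  set y := c.im
  have e : 2 ^ 2 * ((1 - t * x) * (1 - t * x) + t * y * (t * y))
     - (1 + t) ^ 2 * ((1 - x) * (1 - x) + y * y) =
     (1-t) * ((3+t) + 2*x*(1-t) - (x*x+y*y)*(3*t+1)) := by ring
  have h3 : 0 ≤ (3+t) + 2*x*(1-t) - (x*x+y*y)*(3*t+1) := by
    nlinarith [mul_nonneg (sub_nonneg.2 ht.le) (sq_nonneg (x+1)), mul_nonneg (sub_nonneg.2 ht.le) (sq_nonneg y), mul_nonneg ht0 (sub_nonneg.2 hc2)]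
  nlinarith [mul_nonneg (sub_nonneg.2 ht.le) h3]

lemma contraction {F : ℂ → ℂ} (hd : DifferentiableOn ℂ F (Metric.ball 0 1)) {s : ℝ} (hs0 : 0 < s)
    (hs : s < 1) (hm : ∀ z, ‖z‖ < 1 → ‖F z‖ < s) {z p : ℂ} (hz : ‖z‖ < 1) (hp : ‖p‖ < 1) :
    ‖mob (F p) (F z)‖ ≤ 2 * s / (1 + s ^ 2) * ‖mob p z‖ := by
  have hG : ∀ z, ‖z‖ < 1 → ‖F z / s‖ < 1 := by
    intro z hz
    rw [norm_div, Complex.norm_real, Real.norm_of_nonneg hs0.le, div_lt_one hs0]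
    exact hm z hz
  have h := schwarz_pick (G := fun z => F z / s) (hd.div_const _) hG hz hp
  refine le_trans ?_ (mul_le_mul_of_nonneg_left h (by positivity))
  have hs' : (s : ℂ) ≠ 0 := by exact_mod_cast hs0.ne'
  obtain ⟨a, ha⟩ : ∃ a, a = F z / s := ⟨_, rfl⟩
  obtain ⟨b, hb⟩ : ∃ b, b = F p / s := ⟨_, rfl⟩
  have ha' : F z = s * a := by rw [ha]; field_simp
  have hb' : F p = s * b := by rw [hb]; field_simp
  have ha1 : ‖a‖ < 1 := ha ▸ hG z hz
  have hb1 : ‖b‖ < 1 := hb ▸ hG p hp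
  rw [← ha, ← hb, ha', hb']
  have hsb : ∀ a : ℂ, ‖a‖ < 1 → ‖(s : ℂ) * a‖ < 1 := by
    intro a h
    rw [norm_mul, Complex.norm_real, Real.norm_of_nonneg hs0.le]
    nlinarith [norm_nonneg a]
  have d1 := norm_pos_iff.mpr (mob_den_ne hb1 ha1)
  have d2 := norm_pos_iff.mpr (mob_den_ne (hsb b hb1) (hsb a ha1))
  have hob := one_sub_bound (t := s ^ 2) (by positivity) (by nlinarith)
    (c := (starRingEnd ℂ) b * a) (by
      rw [norm_mul, RCLike.norm_conj]; nlinarith [norm_nonneg a, norm_nonneg b])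
  have e : (1 - (starRingEnd ℂ) ((s : ℂ) * b) * (s * a)) =
      1 - ((s ^ 2 : ℝ) : ℂ) * ((starRingEnd ℂ) b * a) := by
    simp; ring
  rw [← e] at hob
  unfold mob
  rw [← mul_sub, norm_div, norm_div, norm_mul, Complex.norm_real, Real.norm_of_nonneg hs0.le,
    div_mul_div_comm, div_le_div_iff₀ d2 (by positivity)]
  nlinarith [mul_le_mul_of_nonneg_left hob (mul_nonneg hs0.le (norm_nonneg (a - b)))]

/-- The exponential factor. -/
noncomputable def eFac (σ : Measure ℂ) (z : ℂ) : ℂ := Complex.exp (-(∫ ξ, (ξ + z) / (ξ - z) ∂σ))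

lemma ae_sphere {σ : Measure ℂ} (hσ : σ ((Metric.sphere (0 : ℂ) 1)ᶜ) = 0) : ∀ᵐ ξ ∂σ, ‖ξ‖ = 1 := by
  have : ∀ᵐ ξ ∂σ, ξ ∈ Metric.sphere (0 : ℂ) 1 := by
    rw [ae_iff]; exact hσ
  filter_upwards [this] with ξ h
  simpa using h

lemma kernel_int {σ : Measure ℂ} [IsFiniteMeasure σ] (hσ : σ ((Metric.sphere (0 : ℂ) 1)ᶜ) = 0)
    {z : ℂ} (hz : ‖z‖ < 1) : Integrable (fun ξ => (ξ + z) / (ξ - z)) σ := by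
  refine Integrable.of_bound (C := 2 / (1 - ‖z‖)) ?_ ?_
  · exact Measurable.aestronglyMeasurable (by fun_prop)
  · filter_upwards [ae_sphere hσ] with ξ h
    have := norm_sub_norm_le ξ z
    have := norm_add_le ξ z
    rw [norm_div]
    apply div_le_div₀ <;> linarith

lemma q_diff {σ : Measure ℂ} [IsFiniteMeasure σ] (hσ : σ ((Metric.sphere (0 : ℂ) 1)ᶜ) = 0)
    {z : ℂ} (hz : ‖z‖ < 1) : DifferentiableAt ℂ (fun z => ∫ ξ, (ξ + z) / (ξ - z) ∂σ) z := by
  obtain ⟨R, hzR, hR⟩ := exists_between hz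
  have := (hasDerivAt_integral_of_dominated_loc_of_deriv_le (μ := σ) (𝕜 := ℂ)
    (F := fun z ξ => (ξ + z) / (ξ - z)) (x₀ := z) (s := Metric.ball 0 R)
    (bound := fun _ => 2 / (1 - R) ^ 2)
    (F' := fun z ξ => (1 * (ξ - z) - (ξ + z) * (-1)) / (ξ - z) ^ 2)
    (Metric.isOpen_ball.mem_nhds (by simpa using hzR))
    (Eventually.of_forall fun x => Measurable.aestronglyMeasurable (by fun_prop))
    (kernel_int hσ hz) (Measurable.aestronglyMeasurable (by fun_prop)) ?_ (integrable_const _) ?_).2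
  · exact this.differentiableAt
  · filter_upwards [ae_sphere hσ] with ξ h x hx
    rw [mem_ball_zero_iff] at hx
    have := norm_sub_norm_le ξ x
    have e : 1 * (ξ - x) - (ξ + x) * (-1) = 2 * ξ := by ring
    rw [e, norm_div, norm_mul, h, norm_pow]
    have h1 : 0 < 1 - R := by linarith
    have h2 : 1 - R ≤ ‖ξ - x‖ := by linarith
    simp only [Complex.norm_ofNat, mul_one]
    gcongr
  · filter_upwards [ae_sphere hσ] with ξ h x hx
    rw [mem_ball_zero_iff] at hx
    have hne : ξ - x ≠ 0 := by
      intro h0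
      rw [sub_eq_zero] at h0
      subst h0; linarith
    exact ((hasDerivAt_id x).const_add ξ).fun_div ((hasDerivAt_id x).const_sub ξ) hne

lemma eFac_diff {σ : Measure ℂ} [IsFiniteMeasure σ] (hσ : σ ((Metric.sphere (0 : ℂ) 1)ᶜ) = 0)
    {z : ℂ} (hz : ‖z‖ < 1) : DifferentiableAt ℂ (eFac σ) z :=
  (q_diff hσ hz).neg.cexp

lemma eFac_le {σ : Measure ℂ} [IsFiniteMeasure σ] (hσ : σ ((Metric.sphere (0 : ℂ) 1)ᶜ) = 0)
    {z : ℂ} (hz : ‖z‖ < 1) : ‖eFac σ z‖ ≤ 1 := by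
  rw [eFac, Complex.norm_exp, Real.exp_le_one_iff, Complex.neg_re, neg_nonpos]
  have h : (∫ ξ, ((ξ + z) / (ξ - z)).re ∂σ) = (∫ ξ, (ξ + z) / (ξ - z) ∂σ).re :=
    integral_re (𝕜 := ℂ) (kernel_int hσ hz)
  rw [← h]
  apply integral_nonneg_of_ae
  filter_upwards [ae_sphere hσ] with ξ h
  have hz2 : ‖z‖ ^ 2 < 1 := by nlinarith [norm_nonneg z]
  have hx2 : ‖ξ‖ ^ 2 = 1 := by rw [h]; norm_num
  simp only [Complex.sq_norm, Complex.normSq_apply] at hz2 hx2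
  simp only [Pi.zero_apply, Complex.div_re]
  rw [← add_div]
  apply div_nonneg _ (Complex.normSq_nonneg _)
  simp
  nlinarith

lemma abstract_fixed {E : ℂ → ℂ} (hE : ∀ z, ‖z‖ < 1 → DifferentiableAt ℂ E z)
    (hE1 : ∀ z, ‖z‖ < 1 → ‖E z‖ ≤ 1) :
    (∀ w, ‖w‖ < 1 → ∀ z p, ‖z‖ < 1 → ‖p‖ < 1 → z = w * E z → p = w * E p → z = p) ∧
    ∃ h : ℂ → ℂ, DifferentiableOn ℂ h (Metric.ball 0 1) ∧
      ∀ w, ‖w‖ < 1 → ‖h w‖ < 1 ∧ h w = w * E (h w) := by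
  have con : ∀ s : ℝ, 0 < s → s < 1 → ∀ w, ‖w‖ < s → ∀ z p, ‖z‖ < 1 → ‖p‖ < 1 →
      ‖mob (w * E p) (w * E z)‖ ≤ 2 * s / (1 + s ^ 2) * ‖mob p z‖ := by
    intro s hs0 hs w hw z p hz hp
    refine contraction (F := fun z => w * E z) ?_ hs0 hs ?_ hz hp
    · intro x hx
      exact ((hE x (by simpa using hx)).const_mul w).differentiableWithinAt
    · intro x hx
      rw [norm_mul]
      nlinarith [hE1 x hx, norm_nonneg w, norm_nonneg (E x)]
  have k1 : ∀ s : ℝ, 0 < s → s < 1 → 2 * s / (1 + s ^ 2) < 1 := by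
    intro s hs0 hs
    rw [div_lt_one (by positivity)]
    nlinarith [sq_pos_of_pos (sub_pos.2 hs)]
  have le2 : ∀ z p : ℂ, ‖z‖ < 1 → ‖p‖ < 1 → ‖z - p‖ ≤ 2 * ‖mob p z‖ := by
    intro z p hz hp
    have d := norm_pos_iff.mpr (mob_den_ne hp hz)
    rw [mob, norm_div, mul_div_assoc', le_div_iff₀ d]
    have : ‖1 - (starRingEnd ℂ) p * z‖ ≤ 2 := by
      refine (norm_sub_le _ _).trans ?_
      rw [norm_mul, RCLike.norm_conj, norm_one]
      nlinarith [norm_nonneg p, norm_nonneg z]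
    nlinarith [norm_nonneg (z - p)]
  refine ⟨?_, ?_⟩
  · intro w hw z p hz hp hz' hp'
    obtain ⟨s, hs1, hs2⟩ := exists_between hw
    have hs0 : 0 < s := (norm_nonneg w).trans_lt hs1
    have h := con s hs0 hs2 w hs1 z p hz hp
    rw [← hz', ← hp'] at h
    have h0 : ‖mob p z‖ = 0 := by nlinarith [norm_nonneg (mob p z), k1 s hs0 hs2]
    have h2 := le2 z p hz hp
    rw [h0, mul_zero] at h2
    exact sub_eq_zero.mp (norm_le_zero_iff.mp h2)
  · let u : ℕ → ℂ → ℂ := fun n w => (fun z => w * E z)^[n] 0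
    have us : ∀ n w, u (n + 1) w = w * E (u n w) := by
      intro n w
      simp only [u, Function.iterate_succ_apply']
    have u0 : ∀ w, u 0 w = 0 := fun w => rfl
    have ule : ∀ n w, ‖w‖ < 1 → ‖u n w‖ ≤ ‖w‖ := by
      intro n w hw
      induction n with
      | zero => rw [u0]; simp
      | succ n ih =>
        rw [us, norm_mul]
        nlinarith [hE1 _ (ih.trans_lt hw), norm_nonneg w]
    have ult : ∀ n w, ‖w‖ < 1 → ‖u n w‖ < 1 := fun n w hw => (ule n w hw).trans_lt hw
    have ud : ∀ n w, ‖w‖ < 1 → DifferentiableAt ℂ (u n) w := by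
      intro n w hw
      induction n with
      | zero => exact differentiableAt_const 0
      | succ n ih =>
        have : u (n + 1) = fun w => w * E (u n w) := funext (us n)
        rw [this]
        exact differentiableAt_id.mul ((hE _ (ult n w hw)).comp w ih)
    have umob : ∀ s : ℝ, 0 < s → s < 1 → ∀ w, ‖w‖ < s → ∀ n,
        ‖mob (u (n + 1) w) (u n w)‖ ≤ (2 * s / (1 + s ^ 2)) ^ n := by
      intro s hs0 hs w hw n
      have hw1 := hw.trans hs
      induction n with
      | zero => simpa using (mob_lt (ult 1 w hw1) (ult 0 w hw1)).le
      | succ n ih =>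
        rw [pow_succ']
        have hc := (con s hs0 hs w hw _ _ (ult n w hw1) (ult (n + 1) w hw1))
        rw [← us n, ← us (n + 1)] at hc
        refine hc.trans ?_
        gcongr
    have udist : ∀ s : ℝ, 0 < s → s < 1 → ∀ w, ‖w‖ < s → ∀ n,
        dist (u n w) (u (n + 1) w) ≤ 2 * (2 * s / (1 + s ^ 2)) ^ n := by
      intro s hs0 hs w hw n
      have hw1 := hw.trans hs
      rw [dist_eq_norm]
      have := le2 _ _ (ult n w hw1) (ult (n + 1) w hw1)
      have := umob s hs0 hs w hw n
      linarith
    have ulim : ∀ w, ∃ l, ‖w‖ < 1 → Tendsto (fun n => u n w) atTop (nhds l) := by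
      intro w
      by_cases hw : ‖w‖ < 1
      · obtain ⟨s, hs1, hs2⟩ := exists_between hw
        have hs0 : 0 < s := (norm_nonneg w).trans_lt hs1
        obtain ⟨l, hl⟩ := cauchySeq_tendsto_of_complete
          (cauchySeq_of_le_geometric _ _ (k1 s hs0 hs2) (udist s hs0 hs2 w hs1))
        exact ⟨l, fun _ => hl⟩
      · exact ⟨0, fun h => absurd h hw⟩
    choose h hh using ulim
    have hle : ∀ w, ‖w‖ < 1 → ‖h w‖ ≤ ‖w‖ := fun w hw =>
      le_of_tendsto (hh w hw).norm (Eventually.of_forall fun n => ule n w hw)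
    refine ⟨h, ?_, ?_⟩
    · have hlu : TendstoLocallyUniformlyOn u h atTop (Metric.ball 0 1) := by
        rw [Metric.tendstoLocallyUniformlyOn_iff]
        intro ε hε w hw
        rw [mem_ball_zero_iff] at hw
        obtain ⟨s, hs1, hs2⟩ := exists_between hw
        have hs0 : 0 < s := (norm_nonneg w).trans_lt hs1
        refine ⟨Metric.ball 0 s, mem_nhdsWithin_of_mem_nhds
          (Metric.isOpen_ball.mem_nhds (by simpa using hs1)), ?_⟩
        have ht : Tendsto (fun n : ℕ => 2 * (2 * s / (1 + s ^ 2)) ^ n / (1 - 2 * s / (1 + s ^ 2)))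
            atTop (nhds 0) := by
          have := ((tendsto_pow_atTop_nhds_zero_of_lt_one (r := 2 * s / (1 + s ^ 2))
            (by positivity) (k1 s hs0 hs2)).const_mul 2).div_const (1 - 2 * s / (1 + s ^ 2))
          simpa using this
        filter_upwards [ht.eventually_lt_const hε] with n hn y hy
        rw [mem_ball_zero_iff] at hy
        rw [dist_comm]
        exact (dist_le_of_le_geometric_of_tendsto _ _ (k1 s hs0 hs2) (udist s hs0 hs2 y hy)
          (hh y (hy.trans hs2)) n).trans_lt hn
      refine hlu.differentiableOn (Eventually.of_forall fun n w hw => ?_) Metric.isOpen_ball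
      exact (ud n w (by simpa using hw)).differentiableWithinAt
    · intro w hw
      have h1 := (hle w hw).trans_lt hw
      refine ⟨h1, ?_⟩
      have t1 := (tendsto_add_atTop_iff_nat 1).mpr (hh w hw)
      have t2 : Tendsto (fun n => u (n + 1) w) atTop (nhds (w * E (h w))) := by
        simp only [us]
        exact ((hE _ h1).continuousAt.tendsto.comp (hh w hw)).const_mul w
      exact tendsto_nhds_unique t1 t2

/-- Lemma 5.6: for a nonzero finite nonnegative measure σ on 𝕋, the function
Q₂(z) = z·exp(∫ (ξ+z)/(ξ−z) dσ(ξ)) takes every value of 𝔻 precisely once, and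
its inverse belongs to the class 𝒮_*. -/
theorem disk_exponential_value_once (σ : Measure ℂ) (hσfin : IsFiniteMeasure σ)
    (hσsupp : σ ((Metric.sphere (0 : ℂ) 1)ᶜ) = 0) (hσne : σ ≠ 0) :
    (∀ w ∈ unitDisk, ∃! z : ℂ, z ∈ unitDisk ∧
      z * Complex.exp (∫ ξ, (ξ + z) / (ξ - z) ∂σ) = w) ∧
    ∃ h : ℂ → ℂ, schurStar h ∧
      ∀ w ∈ unitDisk, h w ∈ unitDisk ∧
        h w * Complex.exp (∫ ξ, (ξ + h w) / (ξ - h w) ∂σ) = w := by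
  have md : ∀ z : ℂ, z ∈ unitDisk ↔ ‖z‖ < 1 := fun z => mem_ball_zero_iff
  have eqv : ∀ z w : ℂ, z * Complex.exp (∫ ξ, (ξ + z) / (ξ - z) ∂σ) = w ↔ z = w * eFac σ z := by
    intro z w
    rw [eFac, Complex.exp_neg, ← div_eq_mul_inv, eq_div_iff (Complex.exp_ne_zero _)]
  simp only [md, eqv]
  obtain ⟨huniq, h, hd, hh⟩ := abstract_fixed (E := eFac σ) (fun z hz => eFac_diff hσsupp hz)
    (fun z hz => eFac_le hσsupp hz)
  refine ⟨fun w hw => ⟨h w, hh w hw, fun y hy =>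
    huniq w hw y (h w) hy.1 (hh w hw).1 hy.2 (hh w hw).2⟩, h, ⟨hd, ?_, ?_, ?_⟩, hh⟩
  · exact fun z hz => (hh z ((md z).1 hz)).1.le
  · have := (hh 0 (by simp)).2
    simpa using this
  · have h0 : DifferentiableAt ℂ h 0 := hd.differentiableAt (Metric.ball_mem_nhds _ one_pos)
    have hg : DifferentiableAt ℂ (fun w => eFac σ (h w)) 0 :=
      (eFac_diff hσsupp (hh 0 (by simp)).1).comp 0 h0
    have hm : HasDerivAt (fun w => w * eFac σ (h w)) _ 0 := (hasDerivAt_id (0 : ℂ)).mul hg.hasDerivAt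
    have he : h =ᶠ[nhds 0] (fun w => w * eFac σ (h w)) := by
      filter_upwards [Metric.ball_mem_nhds (0 : ℂ) one_pos] with w hw
      exact (hh w (by simpa using hw)).2
    rw [he.deriv_eq, hm.deriv]
    simp [eFac, Complex.exp_ne_zero]
end

section
/- Let a < b be real numbers and let μ be a Borel probability measure on ℝ with μ({a}) > 0, μ([b,∞)) > 0, and μ({a}) + μ([b,∞)) = 1, and suppose that G_μ(x) = ∫_ℝ (x − t)⁻¹ dμ(t), which is well defined for real x ∈ (a,b), satisfies lim_{x ↑ b} G_μ(x) = 0. Then μ is indecomposable with respect to free additive convolution: whenever μ₁, μ₂ are Borel probability measures on ℝ and Z₁, Z₂ are functions in the class 𝓕 satisfying, for all z ∈ ℂ⁺, z = Z₁(z) + Z₂(z) − F_{μ₁}(Z₁(z)) and F_{μ₁}(Z₁(z)) = F_{μ₂}(Z₂(z)) = F_μ(z) (i.e. μ = μ₁ ⊞ μ₂), there exists c ∈ ℝ such that μ₁ = δ_c or μ₂ = δ_c, where δ_c is the Dirac measure at c. -/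
open MeasureTheory Complex Filter Set

/-- Open upper half-plane. -/
def upperHalf : Set ℂ := {z : ℂ | 0 < z.im}

/-- Cauchy transform of a Borel measure on ℝ. -/
noncomputable def cauchyG (μ : Measure ℝ) (z : ℂ) : ℂ := ∫ t, (z - (t : ℂ))⁻¹ ∂μ

/-- Reciprocal Cauchy transform. -/
noncomputable def recF (μ : Measure ℝ) (z : ℂ) : ℂ := (cauchyG μ z)⁻¹

/-- The class 𝓕 of reciprocal Cauchy transforms of Borel probability measures on ℝ
(membership only depends on the values on the upper half-plane). -/
def classF (f : ℂ → ℂ) : Prop :=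
  ∃ μ : Measure ℝ, IsProbabilityMeasure μ ∧ ∀ z ∈ upperHalf, f z = recF μ z

open Topology

lemma norm_sub_real_ge (z : ℂ) (t : ℝ) : |z.im| ≤ ‖z - (t:ℂ)‖ := by
  have := Complex.abs_im_le_norm (z - (t:ℂ))
  simpa using this

lemma norm_sub_real_ge_alt (z : ℂ) (t : ℝ) : |z.re - t| ≤ ‖z - (t:ℂ)‖ := by
  have := Complex.abs_re_le_norm (z - (t:ℂ))
  simpa using this

lemma integrable_inv (μ : Measure ℝ) [IsProbabilityMeasure μ] (z : ℂ) (hz : 0 < z.im) :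
    Integrable (fun t : ℝ => (z - (t:ℂ))⁻¹) μ := by
  refine Integrable.of_bound (C := (z.im)⁻¹) ?_ ?_
  · exact (by fun_prop : Measurable (fun t : ℝ => (z - (t:ℂ))⁻¹)).aestronglyMeasurable
  · filter_upwards with t
    rw [norm_inv]
    have := norm_sub_real_ge z t
    rw [abs_of_pos hz] at this
    gcongr

/-- integral of squared modulus -/
noncomputable def sqI (μ : Measure ℝ) (z : ℂ) : ℝ := ∫ t, (‖z - (t:ℂ)‖⁻¹) ^ 2 ∂μ

lemma integrable_sq (μ : Measure ℝ) [IsProbabilityMeasure μ] (z : ℂ) (hz : 0 < z.im) :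
    Integrable (fun t : ℝ => (‖z - (t:ℂ)‖⁻¹) ^ 2) μ := by
  refine Integrable.of_bound (C := (z.im)⁻¹ ^ 2) ?_ ?_
  · exact (by fun_prop : Measurable (fun t : ℝ => (‖z - (t:ℂ)‖⁻¹) ^ 2)).aestronglyMeasurable
  · filter_upwards with t
    have := norm_sub_real_ge z t
    rw [abs_of_pos hz] at this
    rw [Real.norm_of_nonneg (by positivity)]
    gcongr

lemma cauchyG_im (μ : Measure ℝ) [IsProbabilityMeasure μ] (z : ℂ) (hz : 0 < z.im) :
    (cauchyG μ z).im = - z.im * sqI μ z := by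
  unfold cauchyG sqI
  have h := integral_im (integrable_inv μ z hz)
  simp only [RCLike.im_to_complex] at h
  rw [← h, ← integral_const_mul]
  congr 1
  ext t
  rw [Complex.inv_im, Complex.normSq_eq_norm_sq]
  simp
  ring

lemma normG_sq_le (μ : Measure ℝ) [IsProbabilityMeasure μ] (z : ℂ) (hz : 0 < z.im) :
    ‖cauchyG μ z‖ ^ 2 ≤ sqI μ z := by
  set m := ‖cauchyG μ z‖ with hm
  have h1 : m ≤ ∫ t, ‖z - (t:ℂ)‖⁻¹ ∂μ := by
    have := norm_integral_le_integral_norm (μ := μ) (fun t : ℝ => (z - (t:ℂ))⁻¹)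
    simp only [norm_inv] at this
    exact this
  have hi : Integrable (fun t : ℝ => ‖z - (t:ℂ)‖⁻¹) μ := by
    simpa [norm_inv] using (integrable_inv μ z hz).norm
  have h2 : 0 ≤ ∫ t, (‖z - (t:ℂ)‖⁻¹ - m) ^ 2 ∂μ := integral_nonneg fun _ => sq_nonneg _
  have h3 : ∫ t, (‖z - (t:ℂ)‖⁻¹ - m) ^ 2 ∂μ
      = sqI μ z - 2 * m * (∫ t, ‖z - (t:ℂ)‖⁻¹ ∂μ) + m ^ 2 := by
    have : ∀ t : ℝ, (‖z - (t:ℂ)‖⁻¹ - m) ^ 2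
      = (‖z - (t:ℂ)‖⁻¹) ^ 2 - 2 * m * ‖z - (t:ℂ)‖⁻¹ + m ^ 2 := fun t => by ring
    simp_rw [this]
    have hs : Integrable (fun t : ℝ => (‖z - (t:ℂ)‖⁻¹) ^ 2 - 2 * m * ‖z - (t:ℂ)‖⁻¹) μ :=
      (integrable_sq μ z hz).sub (hi.const_mul _)
    rw [integral_add hs (integrable_const _), integral_sub (integrable_sq μ z hz) (hi.const_mul _), integral_const_mul]
    simp [sqI]
  have hm0 : 0 ≤ m := norm_nonneg _
  nlinarith [mul_le_mul_of_nonneg_left h1 hm0]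

lemma sqI_nonneg (μ : Measure ℝ) (z : ℂ) : 0 ≤ sqI μ z :=
  integral_nonneg fun _ => sq_nonneg _

lemma sqI_pos (μ : Measure ℝ) [IsProbabilityMeasure μ] (z : ℂ) (hz : 0 < z.im) :
    0 < sqI μ z := by
  unfold sqI
  rw [integral_pos_iff_support_of_nonneg (fun t => by positivity) (integrable_sq μ z hz)]
  have : Function.support (fun t : ℝ => (‖z - (t:ℂ)‖⁻¹) ^ 2) = univ := by
    ext t
    have := norm_sub_real_ge z t
    rw [abs_of_pos hz] at this
    have : 0 < ‖z - (t:ℂ)‖ := by linarith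
    simp only [Function.mem_support, mem_univ, iff_true]
    positivity
  rw [this]; simp

lemma cauchyG_ne (μ : Measure ℝ) [IsProbabilityMeasure μ] (z : ℂ) (hz : 0 < z.im) :
    cauchyG μ z ≠ 0 := by
  intro h
  have h1 := cauchyG_im μ z hz
  rw [h] at h1
  have := mul_pos hz (sqI_pos μ z hz)
  simp at h1
  rcases h1 with h1 | h1 <;> simp [h1] at this

lemma recF_im (μ : Measure ℝ) [IsProbabilityMeasure μ] (z : ℂ) (hz : 0 < z.im) :
    (recF μ z).im = z.im * (sqI μ z / ‖cauchyG μ z‖ ^ 2) := by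
  unfold recF
  rw [Complex.inv_im, Complex.normSq_eq_norm_sq, cauchyG_im μ z hz]
  ring

lemma recF_im_ge (μ : Measure ℝ) [IsProbabilityMeasure μ] (z : ℂ) (hz : 0 < z.im) :
    z.im ≤ (recF μ z).im := by
  rw [recF_im μ z hz]
  have h : 1 ≤ sqI μ z / ‖cauchyG μ z‖ ^ 2 := by
    have := norm_pos_iff.mpr (cauchyG_ne μ z hz)
    rw [le_div_iff₀ (by positivity), one_mul]
    exact normG_sq_le μ z hz
  nlinarith

lemma sqI_le (μ : Measure ℝ) [IsProbabilityMeasure μ] (z : ℂ) (hz : 0 < z.im) (C : ℝ)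
    (h : (recF μ z).im ≤ C * z.im) : sqI μ z ≤ C * ‖cauchyG μ z‖ ^ 2 := by
  rw [recF_im μ z hz, mul_comm C] at h
  have := le_of_mul_le_mul_left h hz
  have h0 := norm_pos_iff.mpr (cauchyG_ne μ z hz)
  rwa [div_le_iff₀ (by positivity)] at this

lemma recF_lip (μ : Measure ℝ) [IsProbabilityMeasure μ] (z w : ℂ) (hz : 0 < z.im) (hw : 0 < w.im)
    (C : ℝ) (h1 : (recF μ z).im ≤ C * z.im) (h2 : (recF μ w).im ≤ C * w.im) :
    ‖recF μ z - recF μ w‖ ≤ C * ‖z - w‖ := by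
  have k1 := sqI_le μ z hz C h1
  have k2 := sqI_le μ w hw C h2
  have p1 := norm_pos_iff.mpr (cauchyG_ne μ z hz)
  have p2 := norm_pos_iff.mpr (cauchyG_ne μ w hw)
  set A := ‖cauchyG μ z‖ with hA
  set B := ‖cauchyG μ w‖ with hB
  have e : cauchyG μ w - cauchyG μ z = ∫ t, (z - w) * ((z - (t:ℂ))⁻¹ * (w - (t:ℂ))⁻¹) ∂μ := by
    unfold cauchyG
    rw [← integral_sub (integrable_inv μ w hw) (integrable_inv μ z hz)]
    congr 1
    ext t
    have n1 : z - (t:ℂ) ≠ 0 := fun h => by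
      have := congrArg Complex.im h; simp at this; linarith
    have n2 : w - (t:ℂ) ≠ 0 := fun h => by
      have := congrArg Complex.im h; simp at this; linarith
    field_simp
    ring
  have e2 : ‖cauchyG μ w - cauchyG μ z‖ ≤ ‖z - w‖ * (C * (A * B)) := by
    rw [e, integral_const_mul, norm_mul]
    gcongr
    have : ‖∫ t, ((z - (t:ℂ))⁻¹ * (w - (t:ℂ))⁻¹) ∂μ‖
        ≤ ∫ t, (B / (2 * A) * (‖z - (t:ℂ)‖⁻¹) ^ 2 + A / (2 * B) * (‖w - (t:ℂ)‖⁻¹) ^ 2) ∂μ := by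
      apply norm_integral_le_of_norm_le
      · exact ((integrable_sq μ z hz).const_mul _).add ((integrable_sq μ w hw).const_mul _)
      · filter_upwards with t
        rw [norm_mul, norm_inv, norm_inv]
        set p := ‖z - (t:ℂ)‖⁻¹
        set q := ‖w - (t:ℂ)‖⁻¹
        have : B / (2 * A) * p ^ 2 + A / (2 * B) * q ^ 2 - p * q
          = (B * p - A * q) ^ 2 / (2 * A * B) := by field_simp; ring
        have h0 : 0 ≤ (B * p - A * q) ^ 2 / (2 * A * B) := by positivity
        linarith
    refine this.trans ?_
    rw [integral_add ((integrable_sq μ z hz).const_mul _) ((integrable_sq μ w hw).const_mul _),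
      integral_const_mul, integral_const_mul]
    change B / (2 * A) * sqI μ z + A / (2 * B) * sqI μ w ≤ _
    calc _ ≤ B / (2 * A) * (C * A ^ 2) + A / (2 * B) * (C * B ^ 2) := by gcongr
      _ = _ := by field_simp; ring
  have e3 : recF μ z - recF μ w = (cauchyG μ w - cauchyG μ z) / (cauchyG μ z * cauchyG μ w) := by
    unfold recF
    have := cauchyG_ne μ z hz
    have := cauchyG_ne μ w hw
    field_simp
  rw [e3, norm_div, norm_mul, div_le_iff₀ (by positivity)]
  calc _ ≤ _ := e2
    _ = _ := by ring

lemma recF_asymp (μ : Measure ℝ) [IsProbabilityMeasure μ] (w : ℂ) (hw : 0 < w.im) :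
    Tendsto (fun R : ℝ => recF μ (R * w) / R) atTop (𝓝 w) := by
  have hw0 : w ≠ 0 := fun h => by simp [h] at hw
  have key : Tendsto (fun R : ℝ => ∫ t, (w - ((t / R : ℝ) : ℂ))⁻¹ ∂μ) atTop
      (𝓝 (∫ _t, w⁻¹ ∂μ)) := by
    apply tendsto_integral_filter_of_dominated_convergence (fun _ => (w.im)⁻¹)
    · filter_upwards with R
      exact (by fun_prop : Measurable (fun t : ℝ => (w - ((t / R : ℝ):ℂ))⁻¹)).aestronglyMeasurable
    · filter_upwards with R
      filter_upwards with t
      rw [norm_inv]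
      have := norm_sub_real_ge w (t / R)
      rw [abs_of_pos hw] at this
      gcongr
    · exact integrable_const _
    · filter_upwards with t
      have h1 : Tendsto (fun R : ℝ => t / R) atTop (𝓝 0) := tendsto_const_nhds.div_atTop tendsto_id
      have h2 := (Complex.continuous_ofReal.tendsto 0).comp h1
      have h3 := (tendsto_const_nhds (x := w)).sub h2
      have h4 := h3.inv₀ (by simpa using hw0)
      simpa using h4
  simp only [integral_const, probReal_univ, one_smul] at key
  have key2 := key.inv₀ (inv_ne_zero hw0)
  rw [inv_inv] at key2
  refine key2.congr' ?_
  filter_upwards [eventually_gt_atTop 0] with R hR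
  have hR_alt : (R:ℂ) ≠ 0 := by exact_mod_cast hR.ne'
  unfold recF cauchyG
  rw [div_eq_mul_inv, ← mul_inv, ← integral_mul_const]
  congr 2
  ext t
  have : (R:ℂ) * w - t = R * (w - ((t / R : ℝ):ℂ)) := by
    push_cast; field_simp
  rw [this, mul_inv]
  field_simp

/-- kernel -/
noncomputable def gK (a : ℝ) (z : ℂ) (t : ℝ) : ℂ := if t = a then 1 else (z - a) / (z - t)

/-- (z - a) G(z) -/
noncomputable def HH (μ : Measure ℝ) (a : ℝ) (z : ℂ) : ℂ := ∫ t, gK a z t ∂μ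

lemma gK_meas (a : ℝ) (z : ℂ) : Measurable (gK a z) := by
  unfold gK
  refine Measurable.ite (measurableSet_singleton a) measurable_const ?_
  fun_prop

lemma gK_eq (a : ℝ) (z : ℂ) (t : ℝ) (hz : z ≠ a) : gK a z t = (z - a) * (z - (t:ℂ))⁻¹ := by
  unfold gK
  split_ifs with h
  · subst h
    rw [mul_inv_cancel₀ (sub_ne_zero.mpr hz)]
  · rw [div_eq_mul_inv]

lemma HH_eq (μ : Measure ℝ) (a : ℝ) (z : ℂ) (hz : z ≠ a) : HH μ a z = (z - a) * cauchyG μ z := by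
  unfold HH cauchyG
  rw [← integral_const_mul]
  congr 1
  ext t
  exact gK_eq a z t hz

lemma ne_real (z : ℂ) (hz : 0 < z.im) (a : ℝ) : z ≠ a := fun h => by simp [h] at hz

lemma sqI_mul_le (μ : Measure ℝ) [IsProbabilityMeasure μ] (a : ℝ) (z : ℂ) (hz : 0 < z.im) (M : ℝ)
    (hM : ∀ᵐ t ∂μ, ‖gK a z t‖ ≤ M) : ‖z - a‖ ^ 2 * sqI μ z ≤ M ^ 2 := by
  unfold sqI
  rw [← integral_const_mul]
  have : ∫ t, ‖z - a‖ ^ 2 * (‖z - (t:ℂ)‖⁻¹) ^ 2 ∂μ ≤ ∫ _t, M ^ 2 ∂μ := by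
    apply integral_mono_ae ((integrable_sq μ z hz).const_mul _) (integrable_const _)
    filter_upwards [hM] with t ht
    rw [gK_eq a z t (ne_real z hz a), norm_mul, norm_inv] at ht
    calc _ = (‖z - a‖ * (‖z - (t:ℂ)‖⁻¹)) ^ 2 := by ring
      _ ≤ _ := by gcongr
  simpa using this

lemma imF_le (μ : Measure ℝ) [IsProbabilityMeasure μ] (a : ℝ) (z : ℂ) (hz : 0 < z.im) (M q : ℝ)
    (hM : ∀ᵐ t ∂μ, ‖gK a z t‖ ≤ M) (hq : 0 < q) (hH : q ≤ ‖HH μ a z‖) :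
    (recF μ z).im ≤ (M / q) ^ 2 * z.im := by
  rw [recF_im μ z hz, mul_comm]
  gcongr
  have h1 := sqI_mul_le μ a z hz M hM
  have hn := ne_real z hz a
  rw [HH_eq μ a z hn, norm_mul] at hH
  have h3 := norm_pos_iff.mpr (cauchyG_ne μ z hz)
  have h4 := norm_pos_iff.mpr (sub_ne_zero.mpr hn)
  have : sqI μ z / ‖cauchyG μ z‖ ^ 2
      = (‖z - a‖ ^ 2 * sqI μ z) / (‖z - a‖ * ‖cauchyG μ z‖) ^ 2 := by
    field_simp
  rw [this, div_pow]
  have : 0 ≤ ‖z - a‖ ^ 2 * sqI μ z := mul_nonneg (by positivity) (sqI_nonneg _ _)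
  gcongr

lemma gK_bound_left (μ : Measure ℝ) (a b : ℝ) (hab : a < b) (hae : ∀ᵐ t ∂μ, t = a ∨ b ≤ t)
    (z : ℂ) (hz : z.re ≤ a) : ∀ᵐ t ∂μ, ‖gK a z t‖ ≤ 1 := by
  filter_upwards [hae] with t ht
  unfold gK
  split_ifs with h
  · simp
  · have ht : b ≤ t := ht.resolve_left h
    rw [norm_div]
    apply div_le_one_of_le₀ _ (norm_nonneg _)
    rw [Complex.norm_def, Complex.norm_def]
    apply Real.sqrt_le_sqrt
    simp only [Complex.normSq_apply, sub_re, ofReal_re, sub_im, ofReal_im, sub_zero]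
    nlinarith

lemma re_HH_ge (μ : Measure ℝ) [IsProbabilityMeasure μ] (a b : ℝ) (hab : a < b)
    (hae : ∀ᵐ t ∂μ, t = a ∨ b ≤ t)
    (z : ℂ) (hz : z.re ≤ a) : μ.real {a} ≤ (HH μ a z).re := by
  have hb := gK_bound_left μ a b hab hae z hz
  have hi : Integrable (gK a z) μ :=
    Integrable.of_bound (gK_meas a z).aestronglyMeasurable 1 hb
  have h := integral_re hi
  simp only [RCLike.re_to_complex] at h
  unfold HH
  rw [← h]
  have h2 := integral_indicator_const (μ := μ) (1:ℝ) (measurableSet_singleton a)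
  rw [smul_eq_mul, mul_one] at h2
  rw [← h2]
  apply integral_mono_ae
  · exact (integrable_const _).indicator (measurableSet_singleton a)
  · exact hi.re
  · filter_upwards [hae] with t ht
    by_cases h : t = a
    · simp [h, gK]
    · have ht : b ≤ t := ht.resolve_left h
      simp only [mem_singleton_iff, h, not_false_eq_true, indicator_of_notMem, gK, if_false]
      rw [Complex.div_re, ← add_div]
      apply div_nonneg _ (Complex.normSq_nonneg _)
      simp only [sub_re, ofReal_re, sub_im, ofReal_im, sub_zero]
      nlinarith [mul_nonneg (sub_nonneg.mpr hz) (by linarith : 0 ≤ t - z.re)]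

lemma gK_bound_near (μ : Measure ℝ) (a b : ℝ) (hae : ∀ᵐ t ∂μ, t = a ∨ b ≤ t)
    (ξ : ℝ) (hξ : ξ < b) (z : ℂ) (hz : ‖z - ξ‖ < (b - ξ) / 2) :
    ∀ᵐ t ∂μ, ‖gK a z t‖ ≤ 1 + (|ξ - a| + (b - ξ) / 2) / ((b - ξ) / 2) := by
  have hd : 0 < b - ξ := by linarith
  filter_upwards [hae] with t ht
  unfold gK
  split_ifs with h
  · simp; positivity
  · have ht : b ≤ t := ht.resolve_left h
    rw [norm_div]
    have h1 : ‖z - a‖ ≤ |ξ - a| + (b - ξ) / 2 := by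
      have : z - a = (z - ξ) + ((ξ - a : ℝ) : ℂ) := by push_cast; ring
      rw [this]
      refine (norm_add_le _ _).trans ?_
      rw [Complex.norm_real, Real.norm_eq_abs]
      linarith
    have h2 : (b - ξ) / 2 ≤ ‖z - t‖ := by
      have e1 := norm_sub_real_ge_alt z t
      have e2 := norm_sub_real_ge_alt z ξ
      have e3 := le_abs_self (z.re - ξ)
      have e4 := neg_abs_le (z.re - t)
      linarith
    have : ‖z - a‖ / ‖z - t‖ ≤ (|ξ - a| + (b - ξ) / 2) / ((b - ξ) / 2) := by
      gcongr
    linarith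

lemma HH_cont (μ : Measure ℝ) [IsProbabilityMeasure μ] (a b : ℝ)
    (hae : ∀ᵐ t ∂μ, t = a ∨ b ≤ t) (ξ : ℝ) (hξ : ξ < b) : ContinuousAt (HH μ a) (ξ:ℂ) := by
  have hd : 0 < b - ξ := by linarith
  unfold HH
  apply continuousAt_of_dominated
    (bound := fun _ => 1 + (|ξ - a| + (b - ξ) / 2) / ((b - ξ) / 2))
  · filter_upwards with z
    exact (gK_meas a z).aestronglyMeasurable
  · filter_upwards [Metric.ball_mem_nhds (ξ:ℂ) (half_pos hd)] with z hz
    rw [Metric.mem_ball, dist_eq_norm] at hz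
    exact gK_bound_near μ a b hae ξ hξ z hz
  · exact integrable_const _
  · filter_upwards [hae] with t ht
    unfold gK
    split_ifs with h
    · exact continuousAt_const
    · have ht : b ≤ t := ht.resolve_left h
      have : (ξ:ℂ) - t ≠ 0 := by
        rw [sub_ne_zero]
        have : ξ ≠ t := by linarith
        exact_mod_cast this
      fun_prop (disch := assumption)

lemma integrable_real (μ : Measure ℝ) [IsProbabilityMeasure μ] (a b : ℝ)
    (hae : ∀ᵐ t ∂μ, t = a ∨ b ≤ t) (x : ℝ) (h1 : a < x) (h2 : x < b) :
    Integrable (fun t : ℝ => (x - t)⁻¹) μ := by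
  refine Integrable.of_bound (C := (x - a)⁻¹ + (b - x)⁻¹)
    (by fun_prop : Measurable (fun t : ℝ => (x - t)⁻¹)).aestronglyMeasurable ?_
  filter_upwards [hae] with t ht
  have p1 : 0 < (x - a)⁻¹ := inv_pos.mpr (by linarith)
  have p2 : 0 < (b - x)⁻¹ := inv_pos.mpr (by linarith)
  rcases ht with ht | ht
  · subst ht
    rw [Real.norm_of_nonneg p1.le]; linarith
  · rw [norm_inv, Real.norm_eq_abs, abs_of_neg (by linarith)]
    have : (-(x - t))⁻¹ ≤ (b - x)⁻¹ := by
      apply inv_anti₀ <;> linarith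
    linarith

lemma cauchyG_real (μ : Measure ℝ) (x : ℝ) :
    cauchyG μ x = ((∫ t, (x - t)⁻¹ ∂μ : ℝ) : ℂ) := by
  unfold cauchyG
  rw [← integral_complex_ofReal]
  congr 1; ext t; push_cast; rfl

lemma realG_pos (μ : Measure ℝ) [IsProbabilityMeasure μ] (a b : ℝ)
    (hae : ∀ᵐ t ∂μ, t = a ∨ b ≤ t) (hp : 0 < μ.real {a})
    (hlim : Filter.Tendsto (fun x : ℝ => cauchyG μ (x : ℂ)) (nhdsWithin b (Set.Iio b)) (nhds 0))
    (ξ : ℝ) (h1 : a < ξ) (h2 : ξ < b) : 0 < ∫ t, (ξ - t)⁻¹ ∂μ := by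
  have hl : Tendsto (fun x : ℝ => ∫ t, (x - t)⁻¹ ∂μ) (𝓝[<] b) (𝓝 0) := by
    have := (Complex.continuous_re.tendsto _).comp hlim
    refine this.congr fun x => ?_
    simp [cauchyG_real]
  have hl2 : Tendsto (fun x : ℝ => (∫ t, (x - t)⁻¹ ∂μ) + μ.real {a} * ((x - ξ) / ((b - a) ^ 2)))
      (𝓝[<] b) (𝓝 (0 + μ.real {a} * ((b - ξ) / ((b - a) ^ 2)))) := by
    apply hl.add
    have : Continuous (fun x : ℝ => μ.real {a} * ((x - ξ) / ((b - a) ^ 2))) := by fun_prop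
    exact (this.tendsto b).mono_left nhdsWithin_le_nhds
  have hle : 0 + μ.real {a} * ((b - ξ) / ((b - a) ^ 2)) ≤ ∫ t, (ξ - t)⁻¹ ∂μ := by
    apply le_of_tendsto hl2
    filter_upwards [Ioo_mem_nhdsLT h2] with x hx
    have h := integral_indicator_const (μ := μ) ((x - ξ) / ((b - a) ^ 2))
      (measurableSet_singleton a)
    rw [smul_eq_mul] at h
    rw [← h, ← integral_add (integrable_real μ a b hae x (by linarith [hx.1]) hx.2)
      ((integrable_const _).indicator (measurableSet_singleton a))]
    apply integral_mono_ae
    · exact (integrable_real μ a b hae x (by linarith [hx.1]) hx.2).add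
        ((integrable_const _).indicator (measurableSet_singleton a))
    · exact integrable_real μ a b hae ξ h1 h2
    · filter_upwards [hae] with t ht
      obtain ⟨hx1, hx2⟩ := hx
      by_cases h : t = a
      · subst h
        simp only [mem_singleton_iff, indicator_of_mem]
        have e : (ξ - t)⁻¹ - (x - t)⁻¹ = (x - ξ) / ((ξ - t) * (x - t)) := by
          have : ξ - t ≠ 0 := by linarith
          have : x - t ≠ 0 := by linarith
          field_simp; ring
        have : (x - ξ) / ((b - t) ^ 2) ≤ (x - ξ) / ((ξ - t) * (x - t)) := by
          have : 0 < (ξ - t) * (x - t) := mul_pos (by linarith) (by linarith)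
          apply div_le_div_of_nonneg_left (by linarith) this
          nlinarith
        linarith
      · have ht : b ≤ t := ht.resolve_left h
        simp only [mem_singleton_iff, h, not_false_eq_true, indicator_of_notMem, add_zero]
        rw [← neg_sub t ξ, ← neg_sub t x, inv_neg, inv_neg]
        apply neg_le_neg
        apply inv_anti₀ <;> linarith
  have : 0 < μ.real {a} * ((b - ξ) / ((b - a) ^ 2)) := by
    have : 0 < b - ξ := by linarith
    have : 0 < b - a := by linarith
    positivity
  linarith

lemma HH_ne (μ : Measure ℝ) [IsProbabilityMeasure μ] (a b : ℝ) (hab : a < b)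
    (hae : ∀ᵐ t ∂μ, t = a ∨ b ≤ t) (hp : 0 < μ.real {a})
    (hlim : Filter.Tendsto (fun x : ℝ => cauchyG μ (x : ℂ)) (nhdsWithin b (Set.Iio b)) (nhds 0))
    (ξ : ℝ) (h2 : ξ < b) : HH μ a ξ ≠ 0 := by
  rcases le_or_gt ξ a with h | h
  · have := re_HH_ge μ a b hab hae (ξ:ℂ) (by simpa using h)
    intro h0
    rw [h0] at this
    simp at this
    linarith
  · have hne : (ξ:ℂ) ≠ a := by exact_mod_cast h.ne'
    rw [HH_eq μ a ξ hne, cauchyG_real]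
    refine mul_ne_zero (sub_ne_zero.mpr hne) ?_
    exact_mod_cast (realG_pos μ a b hae hp hlim ξ h h2).ne'

lemma imF_local (μ : Measure ℝ) [IsProbabilityMeasure μ] (a b : ℝ) (hab : a < b)
    (hae : ∀ᵐ t ∂μ, t = a ∨ b ≤ t) (hp : 0 < μ.real {a})
    (hlim : Filter.Tendsto (fun x : ℝ => cauchyG μ (x : ℂ)) (nhdsWithin b (Set.Iio b)) (nhds 0))
    (ξ : ℝ) (h2 : ξ < b) : ∃ δ > 0, ∃ C ≥ 0, ∀ z : ℂ, 0 < z.im → ‖z - ξ‖ < δ →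
      (recF μ z).im ≤ C * z.im := by
  have hn := norm_pos_iff.mpr (HH_ne μ a b hab hae hp hlim ξ h2)
  have hc := (HH_cont μ a b hae ξ h2).norm
  have hev : ∀ᶠ z in 𝓝 (ξ:ℂ), ‖HH μ a ξ‖ / 2 < ‖HH μ a z‖ :=
    hc.eventually (lt_mem_nhds (half_lt_self hn))
  obtain ⟨δ, hδ, hball⟩ := Metric.eventually_nhds_iff.mp hev
  refine ⟨min δ ((b - ξ) / 2), lt_min hδ (by linarith),
    ((1 + (|ξ - a| + (b - ξ) / 2) / ((b - ξ) / 2)) / (‖HH μ a ξ‖ / 2)) ^ 2, by positivity,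
    fun z hz hzd => ?_⟩
  exact imF_le μ a z hz _ _ (gK_bound_near μ a b hae ξ h2 z (hzd.trans_le (min_le_right _ _)))
    (half_pos hn) (hball (by rw [dist_eq_norm]; exact hzd.trans_le (min_le_left _ _))).le

lemma imF_left (μ : Measure ℝ) [IsProbabilityMeasure μ] (a b : ℝ) (hab : a < b)
    (hae : ∀ᵐ t ∂μ, t = a ∨ b ≤ t) (hp : 0 < μ.real {a}) (z : ℂ) (hz : 0 < z.im)
    (hza : z.re ≤ a) : (recF μ z).im ≤ (1 / μ.real {a}) ^ 2 * z.im :=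
  imF_le μ a z hz _ _ (gK_bound_left μ a b hab hae z hza) hp
    ((re_HH_ge μ a b hab hae z hza).trans (Complex.re_le_norm _))

lemma vert_tendsto (ξ : ℝ) : Tendsto (fun ε : ℝ => (ξ:ℂ) + ε * I) (𝓝[>] 0) (𝓝 (ξ:ℂ)) := by
  have : Continuous (fun ε : ℝ => (ξ:ℂ) + ε * I) := by fun_prop
  have h := this.tendsto 0
  simp only [ofReal_zero, zero_mul, add_zero] at h
  exact h.mono_left nhdsWithin_le_nhds

lemma ext_local (μ ρ : Measure ℝ) [IsProbabilityMeasure μ] [IsProbabilityMeasure ρ]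
    (a b : ℝ) (hab : a < b)
    (hae : ∀ᵐ t ∂μ, t = a ∨ b ≤ t) (hp : 0 < μ.real {a})
    (hlim : Filter.Tendsto (fun x : ℝ => cauchyG μ (x : ℂ)) (nhdsWithin b (Set.Iio b)) (nhds 0))
    (hdom : ∀ z : ℂ, 0 < z.im → (recF ρ z).im ≤ (recF μ z).im)
    (ξ : ℝ) (h2 : ξ < b) : ∃ δ > 0, ∃ K : NNReal, ∃ g : ℂ → ℂ, LipschitzWith K g ∧
      ∀ z : ℂ, 0 < z.im → ‖z - ξ‖ < δ → recF ρ z = g z := by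
  obtain ⟨δ, hδ, C, hC, h⟩ := imF_local μ a b hab hae hp hlim ξ h2
  have hL : LipschitzOnWith ⟨C, hC⟩ (recF ρ) {z : ℂ | 0 < z.im ∧ ‖z - ξ‖ < δ} := by
    apply LipschitzOnWith.of_dist_le_mul
    intro z hz w hw
    rw [dist_eq_norm, dist_eq_norm]
    exact recF_lip ρ z w hz.1 hw.1 C ((hdom z hz.1).trans (h z hz.1 hz.2))
      ((hdom w hw.1).trans (h w hw.1 hw.2))
  obtain ⟨g, hg, he⟩ := hL.extend_finite_dimension
  exact ⟨δ, hδ, _, g, hg, fun z hz hzd => he ⟨hz, hzd⟩⟩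

lemma vert_ev (ξ δ : ℝ) (hδ : 0 < δ) :
    ∀ᶠ ε : ℝ in 𝓝[>] 0, 0 < ((ξ:ℂ) + ε * I).im ∧ ‖(ξ:ℂ) + ε * I - ξ‖ < δ := by
  filter_upwards [Ioo_mem_nhdsGT hδ] with ε hε
  constructor
  · simpa using hε.1
  · simp only [add_sub_cancel_left, norm_mul, Complex.norm_real, norm_I, mul_one,
      Real.norm_eq_abs, abs_of_pos hε.1]
    exact hε.2

lemma bdry_exists (μ ρ : Measure ℝ) [IsProbabilityMeasure μ] [IsProbabilityMeasure ρ]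
    (a b : ℝ) (hab : a < b)
    (hae : ∀ᵐ t ∂μ, t = a ∨ b ≤ t) (hp : 0 < μ.real {a})
    (hlim : Filter.Tendsto (fun x : ℝ => cauchyG μ (x : ℂ)) (nhdsWithin b (Set.Iio b)) (nhds 0))
    (hdom : ∀ z : ℂ, 0 < z.im → (recF ρ z).im ≤ (recF μ z).im) :
    ∃ Zt : ℝ → ℝ, ∀ ξ < b,
      Tendsto (fun ε : ℝ => recF ρ ((ξ:ℂ) + ε * I)) (𝓝[>] 0) (𝓝 (Zt ξ : ℂ)) := by
  have : ∀ ξ : ℝ, ∃ x : ℝ, ξ < b →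
      Tendsto (fun ε : ℝ => recF ρ ((ξ:ℂ) + ε * I)) (𝓝[>] 0) (𝓝 (x : ℂ)) := by
    intro ξ
    by_cases h2 : ξ < b
    swap
    · exact ⟨0, fun h => absurd h h2⟩
    obtain ⟨δ, hδ, K, g, hg, he⟩ := ext_local μ ρ a b hab hae hp hlim hdom ξ h2
    obtain ⟨δ_alt, hδ_alt, C, hC, hCb⟩ := imF_local μ a b hab hae hp hlim ξ h2
    have ht : Tendsto (fun ε : ℝ => recF ρ ((ξ:ℂ) + ε * I)) (𝓝[>] 0) (𝓝 (g ξ)) := by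
      refine ((hg.continuous.tendsto (ξ:ℂ)).comp (vert_tendsto ξ)).congr' ?_
      filter_upwards [vert_ev ξ δ hδ] with ε hε
      exact (he _ hε.1 hε.2).symm
    have him : (g ξ).im = 0 := by
      have t1 := (Complex.continuous_im.tendsto _).comp ht
      have t2 : Tendsto (fun ε : ℝ => C * ε) (𝓝[>] 0) (𝓝 0) := by
        have : Continuous (fun ε : ℝ => C * ε) := by fun_prop
        simpa using (this.tendsto 0).mono_left (nhdsWithin_le_nhds (s := Ioi 0))
      apply le_antisymm
      · apply le_of_tendsto_of_tendsto t1 t2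
        filter_upwards [vert_ev ξ δ_alt hδ_alt] with ε hε
        have := (hdom _ hε.1).trans (hCb _ hε.1 hε.2)
        simpa using this
      · apply ge_of_tendsto t1
        filter_upwards [vert_ev ξ δ_alt hδ_alt] with ε hε
        exact hε.1.le.trans (recF_im_ge ρ _ hε.1)
    refine ⟨(g ξ).re, fun _ => ?_⟩
    have : ((g ξ).re : ℂ) = g ξ := by apply Complex.ext <;> simp [him]
    rwa [this]
  choose Zt h using this
  exact ⟨Zt, fun ξ hξ => h ξ hξ⟩

lemma Zt_eq_ext (ρ : Measure ℝ) (b : ℝ) (Zt : ℝ → ℝ) (hZt : ∀ ξ < b,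
      Tendsto (fun ε : ℝ => recF ρ ((ξ:ℂ) + ε * I)) (𝓝[>] 0) (𝓝 (Zt ξ : ℂ)))
    (ξ δ : ℝ) (g : ℂ → ℂ) (hg : Continuous g)
    (he : ∀ z : ℂ, 0 < z.im → ‖z - ξ‖ < δ → recF ρ z = g z)
    (x : ℝ) (hx : x < b) (hxd : |x - ξ| < δ) : (Zt x : ℂ) = g x := by
  refine tendsto_nhds_unique (hZt x hx) ?_
  refine ((hg.tendsto (x:ℂ)).comp (vert_tendsto x)).congr' ?_
  filter_upwards [vert_ev x (δ - |x - ξ|) (by linarith)] with ε hε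
  refine (he _ hε.1 ?_).symm
  have : (x:ℂ) + ε * I - ξ = ((x:ℂ) + ε * I - x) + ((x - ξ : ℝ) : ℂ) := by push_cast; ring
  rw [this]
  refine (norm_add_le _ _).trans_lt ?_
  rw [Complex.norm_real, Real.norm_eq_abs]
  linarith [hε.2]

lemma Zt_cont (μ ρ : Measure ℝ) [IsProbabilityMeasure μ] [IsProbabilityMeasure ρ]
    (a b : ℝ) (hab : a < b)
    (hae : ∀ᵐ t ∂μ, t = a ∨ b ≤ t) (hp : 0 < μ.real {a})
    (hlim : Filter.Tendsto (fun x : ℝ => cauchyG μ (x : ℂ)) (nhdsWithin b (Set.Iio b)) (nhds 0))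
    (hdom : ∀ z : ℂ, 0 < z.im → (recF ρ z).im ≤ (recF μ z).im)
    (Zt : ℝ → ℝ) (hZt : ∀ ξ < b,
      Tendsto (fun ε : ℝ => recF ρ ((ξ:ℂ) + ε * I)) (𝓝[>] 0) (𝓝 (Zt ξ : ℂ))) : ContinuousOn Zt (Iio b) := by
  intro ξ hξ
  apply ContinuousAt.continuousWithinAt
  obtain ⟨δ, hδ, K, g, hg, he⟩ := ext_local μ ρ a b hab hae hp hlim hdom ξ hξ
  have hc : ContinuousAt (fun x : ℝ => (g x).re) ξ := by
    have := hg.continuous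
    fun_prop
  refine hc.congr ?_
  filter_upwards [Iio_mem_nhds hξ, Metric.ball_mem_nhds ξ hδ] with x hx hxd
  rw [Metric.mem_ball, Real.dist_eq] at hxd
  rw [← Zt_eq_ext ρ b Zt hZt ξ δ g hg.continuous he x hx hxd]
  simp

lemma Zt_unbdd_below (μ ρ : Measure ℝ) [IsProbabilityMeasure μ] [IsProbabilityMeasure ρ]
    (a b : ℝ) (hab : a < b)
    (hae : ∀ᵐ t ∂μ, t = a ∨ b ≤ t) (hp : 0 < μ.real {a})
    (hdom : ∀ z : ℂ, 0 < z.im → (recF ρ z).im ≤ (recF μ z).im)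
    (Zt : ℝ → ℝ) (hZt : ∀ ξ < b,
      Tendsto (fun ε : ℝ => recF ρ ((ξ:ℂ) + ε * I)) (𝓝[>] 0) (𝓝 (Zt ξ : ℂ)))
    (N : ℝ) : ∃ ξ < b, Zt ξ ≤ N := by
  set p := μ.real {a} with hpdef
  set C := (1 / p) ^ 2 with hC
  have hCpos : 0 < C := by positivity
  set θ := 1 / (4 * C) with hθ
  have hθ0 : 0 < θ := by positivity
  set w : ℂ := -1 + θ * I with hw
  have hwim : w.im = θ := by simp [hw]
  have has := recF_asymp ρ w (by rw [hwim]; exact hθ0)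
  have hev := Metric.tendsto_atTop.mp has (1 / 4) (by norm_num)
  obtain ⟨R0, hR0⟩ := hev
  set R := max (max R0 1) (max (-a) (-2 * N)) with hR
  have g1 : R0 ≤ R := (le_max_left _ _).trans (le_max_left _ _)
  have g2 : 1 ≤ R := (le_max_right _ _).trans (le_max_left _ _)
  have g3 : -a ≤ R := (le_max_left _ _).trans (le_max_right _ _)
  have g4 : -2 * N ≤ R := (le_max_right _ _).trans (le_max_right _ _)
  have hRa : -R ≤ a := by linarith
  refine ⟨-R, by linarith, ?_⟩
  have h1 := hR0 R g1
  have hRpos : 0 < R := by linarith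
  have hRC : (R:ℂ) ≠ 0 := by exact_mod_cast hRpos.ne'
  have h2 : ‖recF ρ (R * w) - R * w‖ ≤ R / 4 := by
    rw [dist_eq_norm] at h1
    have : recF ρ (R * w) - R * w = R * (recF ρ (R * w) / R - w) := by field_simp
    rw [this, norm_mul, Complex.norm_real, Real.norm_of_nonneg hRpos.le]
    nlinarith
  have hzim : ((R:ℂ) * w).im = R * θ := by simp [hw]
  have hzre : ((R:ℂ) * w).re = -R := by simp [hw]
  have hRθ : 0 < R * θ := by positivity
  have hlip : ‖recF ρ (R * w) - Zt (-R)‖ ≤ C * (R * θ) := by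
    have t1 : Tendsto (fun ε : ℝ => ‖recF ρ (R * w) - recF ρ (((-R : ℝ):ℂ) + ε * I)‖) (𝓝[>] 0)
        (𝓝 ‖recF ρ (R * w) - Zt (-R)‖) :=
      ((tendsto_const_nhds).sub (hZt (-R) (by linarith))).norm
    apply le_of_tendsto t1
    filter_upwards [Ioo_mem_nhdsGT hRθ] with ε hε
    obtain ⟨e1, e2⟩ := hε
    have k1 := (hdom (R * w) (by rw [hzim]; exact hRθ)).trans
      (imF_left μ a b hab hae hp (R * w) (by rw [hzim]; exact hRθ) (by rw [hzre]; exact hRa))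
    have i2 : 0 < (((-R : ℝ):ℂ) + ε * I).im := by simpa using e1
    have k2 := (hdom _ i2).trans
      (imF_left μ a b hab hae hp (((-R : ℝ):ℂ) + ε * I) i2 (by simpa using hRa))
    have k3 := recF_lip ρ _ _ (by rw [hzim]; exact hRθ) i2 C k1 k2
    refine k3.trans ?_
    gcongr
    have : (R:ℂ) * w - (((-R : ℝ):ℂ) + ε * I) = ((R * θ - ε : ℝ) : ℂ) * I := by
      rw [hw]; push_cast; ring
    rw [this, norm_mul, norm_I, Complex.norm_real, Real.norm_of_nonneg (by linarith)]
    linarith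
  have hCθ : C * (R * θ) = R / 4 := by rw [hθ]; field_simp
  rw [hCθ] at hlip
  have r1 := (Complex.abs_re_le_norm _).trans h2
  have r2 := (Complex.abs_re_le_norm _).trans hlip
  rw [sub_re, hzre] at r1
  rw [sub_re, ofReal_re] at r2
  have := abs_le.mp r1
  have := abs_le.mp r2
  linarith

lemma ball_small (μ ρ : Measure ℝ) [IsProbabilityMeasure μ] [IsProbabilityMeasure ρ]
    (a b : ℝ) (hab : a < b)
    (hae : ∀ᵐ t ∂μ, t = a ∨ b ≤ t) (hp : 0 < μ.real {a})
    (hlim : Filter.Tendsto (fun x : ℝ => cauchyG μ (x : ℂ)) (nhdsWithin b (Set.Iio b)) (nhds 0))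
    (hdom : ∀ z : ℂ, 0 < z.im → (recF ρ z).im ≤ (recF μ z).im)
    (Zt : ℝ → ℝ) (hZt : ∀ ξ < b,
      Tendsto (fun ε : ℝ => recF ρ ((ξ:ℂ) + ε * I)) (𝓝[>] 0) (𝓝 (Zt ξ : ℂ)))
    (μ₁ : Measure ℝ) [IsProbabilityMeasure μ₁]
    (hsub : ∀ z : ℂ, 0 < z.im → recF μ₁ (recF ρ z) = recF μ z)
    (ξ : ℝ) (hξ : ξ < b) (hξa : ξ ≠ a) :
    ∃ K : ℝ, ∀ᶠ ε in 𝓝[>] (0:ℝ), μ₁.real (Metric.closedBall (Zt ξ) ε) ≤ K * ε ^ 2 := by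
  obtain ⟨δ, hδ, L, g, hg, he⟩ := ext_local μ ρ a b hab hae hp hlim hdom ξ hξ
  have hgξ := Zt_eq_ext ρ b Zt hZt ξ δ g hg.continuous he ξ hξ (by simpa using hδ)
  set d := min |ξ - a| (b - ξ) with hd
  have hd0 : 0 < d := lt_min (abs_pos.mpr (sub_ne_zero.mpr hξa)) (by linarith)
  refine ⟨(L + 1) ^ 2 * (d⁻¹) ^ 2, ?_⟩
  filter_upwards [vert_ev ξ δ hδ, self_mem_nhdsWithin] with ε hε hε0
  have hε0 : 0 < ε := hε0
  obtain ⟨e1, e2⟩ := hε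
  set z : ℂ := (ξ:ℂ) + ε * I with hz
  have hzim : z.im = ε := by simp [hz]
  have hzre : z.re = ξ := by simp [hz]
  set w := recF ρ z with hw
  have hwim : ε ≤ w.im := by rw [← hzim]; exact recF_im_ge ρ z e1
  have hw0 : 0 < w.im := by linarith
  have hdist : ‖w - Zt ξ‖ ≤ L * ε := by
    rw [hw, he z e1 e2, hgξ, ← dist_eq_norm]
    refine (hg.dist_le_mul _ _).trans ?_
    rw [dist_eq_norm, hz, add_sub_cancel_left, norm_mul, norm_I, Complex.norm_real,
      Real.norm_of_nonneg hε0.le, mul_one]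
  have hG : cauchyG μ₁ w = cauchyG μ z := inv_injective (hsub z e1)
  have him := congrArg Complex.im hG
  rw [cauchyG_im μ₁ w hw0, cauchyG_im μ z e1, hzim] at him
  have hS1 : sqI μ z ≤ (d⁻¹) ^ 2 := by
    have : sqI μ z ≤ ∫ _t, (d⁻¹) ^ 2 ∂μ := by
      apply integral_mono_ae (integrable_sq μ z e1) (integrable_const _)
      filter_upwards [hae] with t ht
      have h1 := norm_sub_real_ge_alt z t
      rw [hzre] at h1
      have : d ≤ |ξ - t| := by
        rcases ht with ht | ht
        · rw [ht]; exact min_le_left _ _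
        · refine (min_le_right _ _).trans ?_
          rw [abs_of_neg (by linarith)]; linarith
      have : d ≤ ‖z - t‖ := by linarith
      gcongr
    simpa using this
  have hS2 : μ₁.real (Metric.closedBall (Zt ξ) ε) * (((L + 1) * ε)⁻¹) ^ 2 ≤ sqI μ₁ w := by
    have h := integral_indicator_const (μ := μ₁) ((((L:ℝ) + 1) * ε)⁻¹ ^ 2)
      (Metric.isClosed_closedBall (x := Zt ξ) (ε := ε)).measurableSet
    rw [smul_eq_mul] at h
    rw [← h]
    apply integral_mono_ae _ (integrable_sq μ₁ w hw0)
    · filter_upwards with t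
      by_cases ht : t ∈ Metric.closedBall (Zt ξ) ε
      · rw [indicator_of_mem ht]
        have n1 : ‖w - t‖ ≤ (L + 1) * ε := by
          have : w - t = (w - Zt ξ) + ((Zt ξ - t : ℝ) : ℂ) := by push_cast; ring
          rw [this]
          refine (norm_add_le _ _).trans ?_
          rw [Complex.norm_real, ← dist_eq_norm (Zt ξ) t, dist_comm]
          have := Metric.mem_closedBall.mp ht
          linarith
        have n2 := norm_sub_real_ge w t
        rw [abs_of_pos hw0] at n2
        have : 0 < ‖w - t‖ := by linarith
        gcongr
      · rw [indicator_of_notMem ht]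
        positivity
    · exact (integrable_const _).indicator (Metric.isClosed_closedBall).measurableSet
  have hS3 : sqI μ₁ w ≤ sqI μ z := by
    have := sqI_nonneg μ₁ w
    nlinarith
  have hfin := (hS2.trans hS3).trans hS1
  rw [inv_pow, ← div_eq_mul_inv, div_le_iff₀ (by positivity)] at hfin
  calc _ ≤ _ := hfin
    _ = _ := by ring

lemma core_dirac (μ ρ : Measure ℝ) [IsProbabilityMeasure μ] [IsProbabilityMeasure ρ]
    (a b : ℝ) (hab : a < b)
    (hae : ∀ᵐ t ∂μ, t = a ∨ b ≤ t) (hp : 0 < μ.real {a})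
    (hlim : Filter.Tendsto (fun x : ℝ => cauchyG μ (x : ℂ)) (nhdsWithin b (Set.Iio b)) (nhds 0))
    (hdom : ∀ z : ℂ, 0 < z.im → (recF ρ z).im ≤ (recF μ z).im)
    (Zt : ℝ → ℝ) (hZt : ∀ ξ < b,
      Tendsto (fun ε : ℝ => recF ρ ((ξ:ℂ) + ε * I)) (𝓝[>] 0) (𝓝 (Zt ξ : ℂ)))
    (μ₁ : Measure ℝ) [IsProbabilityMeasure μ₁]
    (hsub : ∀ z : ℂ, 0 < z.im → recF μ₁ (recF ρ z) = recF μ z)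
    (hub : ∀ N : ℝ, ∃ ξ < b, N ≤ Zt ξ) : ∃ c : ℝ, μ₁ = Measure.dirac c := by
  refine ⟨Zt a, ?_⟩
  have hsurj : ∀ x : ℝ, ∃ ξ < b, Zt ξ = x := by
    intro x
    obtain ⟨ξ₁, h1, h1_alt⟩ := Zt_unbdd_below μ ρ a b hab hae hp hdom Zt hZt x
    obtain ⟨ξ₂, h2, h2_alt⟩ := hub x
    have := isPreconnected_Iio.intermediate_value (a := ξ₁) (b := ξ₂) h1 h2
      (Zt_cont μ ρ a b hab hae hp hlim hdom Zt hZt)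
    obtain ⟨ξ, hξ, e⟩ := this ⟨h1_alt, h2_alt⟩
    exact ⟨ξ, hξ, e⟩
  have hall : ∀ᵐ x ∂μ₁, x = Zt a := by
    filter_upwards [Besicovitch.ae_tendsto_rnDeriv volume μ₁,
      Measure.rnDeriv_lt_top volume μ₁] with x hx hfin
    by_contra hne
    obtain ⟨ξ, hξ, e⟩ := hsurj x
    have hξa : ξ ≠ a := fun h => hne (by rw [← e, h])
    obtain ⟨K, hK⟩ := ball_small μ ρ a b hab hae hp hlim hdom Zt hZt μ₁ hsub ξ hξ hξa
    rw [e] at hK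
    set l := (volume : Measure ℝ).rnDeriv μ₁ x with hl
    have hl1 : l < l + 1 := ENNReal.lt_add_right hfin.ne one_ne_zero
    have hl2 : l + 1 ≠ ⊤ := by simp [hfin.ne]
    have hev := hx.eventually (gt_mem_nhds hl1)
    set M := (l + 1).toReal with hM
    have hM0 : 0 ≤ M := ENNReal.toReal_nonneg
    have hsmall : ∀ᶠ ε in 𝓝[>] (0:ℝ), M * (K * ε) < 2 := by
      have : Continuous (fun ε : ℝ => M * (K * ε)) := by fun_prop
      have h0 := (this.tendsto 0).mono_left (nhdsWithin_le_nhds (s := Ioi 0))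
      exact h0.eventually (gt_mem_nhds (by simp))
    obtain ⟨ε, h1, h2, h3, h4⟩ := (hK.and (hev.and (hsmall.and self_mem_nhdsWithin))).exists
    have h4 : 0 < ε := h4
    have h5 := (ENNReal.div_le_iff_le_mul (Or.inr hl2) (Or.inl (measure_ne_top _ _))).mp h2.le
    have h6 := ENNReal.toReal_mono (ENNReal.mul_ne_top hl2 (measure_ne_top _ _)) h5
    rw [ENNReal.toReal_mul, Real.volume_closedBall, ENNReal.toReal_ofReal (by linarith)] at h6
    have h7 : 2 * ε ≤ M * (K * ε ^ 2) := h6.trans (mul_le_mul_of_nonneg_left h1 hM0)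
    nlinarith
  have h : μ₁.map id = μ₁.map (fun _ => Zt a) := Measure.map_congr hall
  rw [Measure.map_id, Measure.map_const] at h
  simpa using h

lemma ae_of_sum (a b : ℝ) (hab : a < b) (μ : Measure ℝ) [IsProbabilityMeasure μ]
    (hsum : μ {a} + μ (Set.Ici b) = 1) : ∀ᵐ t ∂μ, t = a ∨ b ≤ t := by
  have hd : Disjoint ({a} : Set ℝ) (Ici b) := by
    simp [hab]
  rw [← measure_union hd measurableSet_Ici] at hsum
  have := (prob_compl_eq_zero_iff
    ((measurableSet_singleton a).union measurableSet_Ici)).mpr hsum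
  filter_upwards [measure_eq_zero_iff_ae_notMem.mp this] with t ht
  have : t ∈ ({a} : Set ℝ) ∪ Ici b := not_not.mp ht
  exact this

lemma F_bdry (μ : Measure ℝ) [IsProbabilityMeasure μ] (a b : ℝ) (hab : a < b)
    (hae : ∀ᵐ t ∂μ, t = a ∨ b ≤ t) (hp : 0 < μ.real {a})
    (hlim : Filter.Tendsto (fun x : ℝ => cauchyG μ (x : ℂ)) (nhdsWithin b (Set.Iio b)) (nhds 0))
    (ξ : ℝ) (h1 : a < ξ) (h2 : ξ < b) :
    Tendsto (fun ε : ℝ => recF μ ((ξ:ℂ) + ε * I)) (𝓝[>] 0)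
      (𝓝 (((∫ t, (ξ - t)⁻¹ ∂μ)⁻¹ : ℝ) : ℂ)) := by
  have hne : (ξ:ℂ) ≠ a := by exact_mod_cast h1.ne'
  have hc := (HH_cont μ a b hae ξ h2)
  have hn := HH_ne μ a b hab hae hp hlim ξ h2
  have hc2 : ContinuousAt (fun z : ℂ => (z - a) / HH μ a z) (ξ:ℂ) :=
    (by fun_prop : ContinuousAt (fun z : ℂ => z - a) (ξ:ℂ)).div hc hn
  have ht := hc2.tendsto.comp (vert_tendsto ξ)
  have e : ((ξ:ℂ) - a) / HH μ a ξ = (((∫ t, (ξ - t)⁻¹ ∂μ)⁻¹ : ℝ) : ℂ) := by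
    rw [HH_eq μ a ξ hne, cauchyG_real, ofReal_inv]
    have := sub_ne_zero.mpr hne
    rw [div_mul_eq_div_div, div_self this, one_div]
  rw [e] at ht
  refine ht.congr' ?_
  filter_upwards [vert_ev ξ 1 one_pos] with ε hε
  have hza := ne_real _ hε.1 a
  simp only [Function.comp]
  rw [HH_eq μ a _ hza, recF, div_mul_eq_div_div, div_self (sub_ne_zero.mpr hza), one_div]

/-- Theorem 8.1: a two-point-type measure with an atom at a, mass on [b,∞), and
G_μ(x) → 0 as x ↑ b is indecomposable for additive free convolution. -/
theorem indecomposable_additive (a b : ℝ) (hab : a < b)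
    (μ : Measure ℝ) (hμ : IsProbabilityMeasure μ)
    (ha : 0 < μ {a}) (hb : 0 < μ (Set.Ici b))
    (hsum : μ {a} + μ (Set.Ici b) = 1)
    (hlim : Filter.Tendsto (fun x : ℝ => cauchyG μ (x : ℂ))
      (nhdsWithin b (Set.Iio b)) (nhds 0)) :
    ∀ μ₁ μ₂ : Measure ℝ, IsProbabilityMeasure μ₁ → IsProbabilityMeasure μ₂ →
      ∀ Z₁ Z₂ : ℂ → ℂ, classF Z₁ → classF Z₂ →
        (∀ z ∈ upperHalf,
          z = Z₁ z + Z₂ z - recF μ₁ (Z₁ z) ∧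
          recF μ₁ (Z₁ z) = recF μ₂ (Z₂ z) ∧
          recF μ₁ (Z₁ z) = recF μ z) →
        ∃ c : ℝ, μ₁ = Measure.dirac c ∨ μ₂ = Measure.dirac c := by
  intro μ₁ μ₂ hμ₁ hμ₂ Z₁ Z₂ ⟨ρ₁, hρ₁, hZ₁⟩ ⟨ρ₂, hρ₂, hZ₂⟩ h
  have hae := ae_of_sum a b hab μ hsum
  have hp : 0 < μ.real {a} := by
    rw [measureReal_def]
    exact ENNReal.toReal_pos ha.ne' (measure_ne_top _ _)
  have hrel : ∀ z : ℂ, 0 < z.im → z + recF μ z = recF ρ₁ z + recF ρ₂ z ∧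
      recF μ₁ (recF ρ₁ z) = recF μ z ∧ recF μ₂ (recF ρ₂ z) = recF μ z := by
    intro z hz
    obtain ⟨h1, h2, h3⟩ := h z hz
    rw [h3] at h1 h2
    rw [hZ₁ z hz] at h1 h3
    rw [hZ₂ z hz] at h1 h2
    refine ⟨?_, h3, h2.symm⟩
    linear_combination h1
  have hdom₁ : ∀ z : ℂ, 0 < z.im → (recF ρ₁ z).im ≤ (recF μ z).im := by
    intro z hz
    have := congrArg Complex.im (hrel z hz).1
    simp only [add_im] at this
    linarith [recF_im_ge ρ₂ z hz]
  have hdom₂ : ∀ z : ℂ, 0 < z.im → (recF ρ₂ z).im ≤ (recF μ z).im := by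
    intro z hz
    have := congrArg Complex.im (hrel z hz).1
    simp only [add_im] at this
    linarith [recF_im_ge ρ₁ z hz]
  obtain ⟨A, hA⟩ := bdry_exists μ ρ₁ a b hab hae hp hlim hdom₁
  obtain ⟨B, hB⟩ := bdry_exists μ ρ₂ a b hab hae hp hlim hdom₂
  by_cases hub₁ : ∀ N : ℝ, ∃ ξ < b, N ≤ A ξ
  · obtain ⟨c, hc⟩ := core_dirac μ ρ₁ a b hab hae hp hlim hdom₁ A hA μ₁
      (fun z hz => (hrel z hz).2.1) hub₁
    exact ⟨c, Or.inl hc⟩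
  by_cases hub₂ : ∀ N : ℝ, ∃ ξ < b, N ≤ B ξ
  · obtain ⟨c, hc⟩ := core_dirac μ ρ₂ a b hab hae hp hlim hdom₂ B hB μ₂
      (fun z hz => (hrel z hz).2.2) hub₂
    exact ⟨c, Or.inr hc⟩
  exfalso
  push Not at hub₁ hub₂
  obtain ⟨N₁, hN₁⟩ := hub₁
  obtain ⟨N₂, hN₂⟩ := hub₂
  have hbd : ∀ ξ : ℝ, a < ξ → ξ < b → ξ + (∫ t, (ξ - t)⁻¹ ∂μ)⁻¹ < N₁ + N₂ := by
    intro ξ h1 h2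
    have t1 := (vert_tendsto ξ).add (F_bdry μ a b hab hae hp hlim ξ h1 h2)
    have t2 := (hA ξ h2).add (hB ξ h2)
    have e := tendsto_nhds_unique (t1.congr' (by
      filter_upwards [vert_ev ξ 1 one_pos] with ε hε
      exact (hrel _ hε.1).1)) t2
    have e_alt : ξ + (∫ t, (ξ - t)⁻¹ ∂μ)⁻¹ = A ξ + B ξ := by exact_mod_cast e
    linarith [hN₁ ξ h2, hN₂ ξ h2]
  have hl : Tendsto (fun x : ℝ => ∫ t, (x - t)⁻¹ ∂μ) (𝓝[<] b) (𝓝[>] 0) := by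
    rw [tendsto_nhdsWithin_iff]
    constructor
    · have := (Complex.continuous_re.tendsto _).comp hlim
      refine this.congr fun x => ?_
      simp [cauchyG_real]
    · filter_upwards [Ioo_mem_nhdsLT hab] with x hx
      exact realG_pos μ a b hae hp hlim x hx.1 hx.2
  have hinf := tendsto_inv_nhdsGT_zero.comp hl
  have hev := hinf.eventually (eventually_ge_atTop (N₁ + N₂ - a))
  obtain ⟨ξ, h1, h2⟩ := (hev.and (Ioo_mem_nhdsLT hab)).exists
  have := hbd ξ h2.1 h2.2
  simp only [Function.comp] at h1
  linarith [h2.1]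
end

section
/- Let 0 < a < b and let μ ∈ ℳ₊ satisfy μ((0,a]) > 0, μ({b}) > 0, and μ([0,a]) + μ({b}) = 1, and suppose that ψ_μ(x), which is well defined and real for real x ∈ (1/b, 1/a), satisfies lim_{x ↑ 1/a} ψ_μ(x) ≥ −1. Then μ is indecomposable with respect to free multiplicative convolution on [0,∞): whenever μ₁, μ₂ ∈ ℳ₊ and Z₁, Z₂ are functions in the Krein class 𝒦 satisfying, for all z ∈ ℂ⁺, Z₁(z)·Z₂(z) = z·K_{μ₁}(Z₁(z)) and K_{μ₁}(Z₁(z)) = K_{μ₂}(Z₂(z)) = K_μ(z) (i.e. μ = μ₁ ⊠ μ₂), there exists c ∈ (0,∞) such that μ₁ = δ_c or μ₂ = δ_c, where δ_c is the Dirac measure at c. -/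
open MeasureTheory Complex Filter Set

/-- The domain ℂ ∖ [0,∞). -/
def kreinDomain : Set ℂ := {z : ℂ | z.im ≠ 0 ∨ z.re < 0}

/-- The Krein class 𝒦: functions analytic on ℂ ∖ [0,∞), real-symmetric,
mapping ℂ⁺ into ℂ⁺ ∪ ℝ, real and nonpositive on (−∞,0), tending to 0 at 0 from the left. -/
def kreinClass (f : ℂ → ℂ) : Prop :=
  DifferentiableOn ℂ f kreinDomain ∧
  (∀ z ∈ kreinDomain, f (starRingEnd ℂ z) = starRingEnd ℂ (f z)) ∧
  (∀ z ∈ upperHalf, 0 ≤ (f z).im) ∧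
  (∀ x : ℝ, x < 0 → (f (x : ℂ)).im = 0 ∧ (f (x : ℂ)).re ≤ 0) ∧
  Filter.Tendsto (fun x : ℝ => f (-(x : ℂ))) (nhdsWithin 0 (Set.Ioi 0)) (nhds 0)

/-- The class ℳ₊ of Borel probability measures on [0,∞) with μ({0}) < 1. -/
def MPlus (μ : Measure ℝ) : Prop :=
  IsProbabilityMeasure μ ∧ μ (Set.Iio 0) = 0 ∧ μ {0} < 1

/-- ψ_μ(z) = ∫ zξ/(1 − zξ) dμ(ξ). -/
noncomputable def psiPlus (μ : Measure ℝ) (z : ℂ) : ℂ :=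
  ∫ t, (z * (t : ℂ)) / (1 - z * (t : ℂ)) ∂μ

/-- K_μ = ψ_μ/(1 + ψ_μ). -/
noncomputable def KPlus (μ : Measure ℝ) (z : ℂ) : ℂ :=
  psiPlus μ z / (1 + psiPlus μ z)


open scoped Topology

lemma isOpen_uh : IsOpen upperHalf := isOpen_lt continuous_const Complex.continuous_im

lemma norm_sq_sub_conj (a b : ℂ) :
    ‖a - (starRingEnd ℂ) b‖ ^ 2 = ‖a - b‖ ^ 2 + 4 * (a.im * b.im) := by
  rw [← Complex.normSq_eq_norm_sq, ← Complex.normSq_eq_norm_sq]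
  simp [Complex.normSq_apply]; ring

/-- Schwarz-Pick in the upper half-plane. -/
lemma schwarz_pick_s19 {f : ℂ → ℂ} (hd : DifferentiableOn ℂ f upperHalf)
    (hm : ∀ z ∈ upperHalf, f z ∈ upperHalf) {z w : ℂ} (hz : z ∈ upperHalf) (hw : w ∈ upperHalf) :
    ‖f z - f w‖ ^ 2 * (z.im * w.im) ≤ ‖z - w‖ ^ 2 * ((f z).im * (f w).im) := by
  have hz' : 0 < z.im := hz
  have hw' : 0 < w.im := hw
  have hfz : 0 < (f z).im := hm z hz
  have hfw : 0 < (f w).im := hm w hw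
  have key : ∀ a b : ℂ, 0 < a.im → 0 < b.im → a - (starRingEnd ℂ) b ≠ 0 := by
    intro a b ha hb h
    have := congrArg Complex.im h
    simp at this; linarith
  set φ : ℂ → ℂ := fun ζ => (w - (starRingEnd ℂ) w * ζ) / (1 - ζ) with hφ
  have hball : ∀ ζ ∈ Metric.ball (0 : ℂ) 1, (1 - ζ) ≠ 0 := by
    intro ζ hζ h
    have : ζ = 1 := by linear_combination -h
    simp [this] at hζ
  have hφm : ∀ ζ ∈ Metric.ball (0 : ℂ) 1, φ ζ ∈ upperHalf := by
    intro ζ hζ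
    have h1 := hball ζ hζ
    have h2 : 0 < Complex.normSq (1 - ζ) := Complex.normSq_pos.2 h1
    have h3 : ζ.re ^ 2 + ζ.im ^ 2 < 1 := by
      have : ‖ζ‖ < 1 := by simpa using hζ
      have h4 : Complex.normSq ζ < 1 := by
        rw [Complex.normSq_eq_norm_sq]; nlinarith [norm_nonneg ζ]
      rw [Complex.normSq_apply] at h4; nlinarith
    show 0 < (φ ζ).im
    have : (φ ζ).im = w.im * (1 - (ζ.re ^ 2 + ζ.im ^ 2)) / Complex.normSq (1 - ζ) := by
      rw [hφ]; simp only [Complex.div_im]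
      simp
      field_simp
      ring
    rw [this]
    apply div_pos (mul_pos hw' (by linarith)) h2
  set h : ℂ → ℂ := fun ζ => (f (φ ζ) - f w) / (f (φ ζ) - (starRingEnd ℂ) (f w)) with hh
  have hφd : DifferentiableOn ℂ φ (Metric.ball 0 1) := by
    apply DifferentiableOn.div
    · fun_prop
    · fun_prop
    · exact hball
  have hfφ : DifferentiableOn ℂ (fun ζ => f (φ ζ)) (Metric.ball 0 1) :=
    hd.comp hφd hφm
  have hhd : DifferentiableOn ℂ h (Metric.ball 0 1) := by
    apply DifferentiableOn.div
    · exact hfφ.sub_const _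
    · exact hfφ.sub_const _
    · intro ζ hζ
      exact key _ _ (hm _ (hφm ζ hζ)) hfw
  have hmaps : MapsTo h (Metric.ball 0 1) (Metric.closedBall 0 1) := by
    intro ζ hζ
    have hp : 0 < (f (φ ζ)).im := hm _ (hφm ζ hζ)
    simp only [hh, Metric.mem_closedBall, dist_zero_right, norm_div]
    apply div_le_one_of_le₀ _ (norm_nonneg _)
    have := norm_sq_sub_conj (f (φ ζ)) (f w)
    apply le_of_sq_le_sq _ (norm_nonneg _)
    rw [this]; nlinarith [mul_pos hp hfw]
  have h0 : h 0 = 0 := by simp [hh, hφ]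
  have hzw := key z w hz' hw'
  have hn1 := norm_sq_sub_conj z w
  have hn2 := norm_sq_sub_conj (f z) (f w)
  have hpz : 0 < ‖z - (starRingEnd ℂ) w‖ := norm_pos_iff.2 hzw
  have hpf : 0 < ‖f z - (starRingEnd ℂ) (f w)‖ := norm_pos_iff.2 (key _ _ hfz hfw)
  set ζ0 := (z - w) / (z - (starRingEnd ℂ) w) with hζ0
  have hζn : ‖ζ0‖ < 1 := by
    rw [hζ0, norm_div, div_lt_one hpz]
    apply lt_of_pow_lt_pow_left₀ 2 (norm_nonneg _)
    rw [hn1]; nlinarith [mul_pos hz' hw']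
  have hφζ : φ ζ0 = z := by
    have h1 : (1 - ζ0) ≠ 0 := hball ζ0 (by simpa using hζn)
    have h2 : w - (starRingEnd ℂ) w ≠ 0 := key w w hw' hw'
    rw [hφ]; simp only
    rw [div_eq_iff h1, hζ0]
    field_simp
    ring
  have hS := Complex.norm_le_norm_of_mapsTo_ball hhd hmaps h0 hζn
  rw [hh] at hS; simp only [hφζ] at hS
  rw [hζ0, norm_div, norm_div, div_le_div_iff₀ hpf hpz] at hS
  have hS2 : (‖f z - f w‖ * ‖z - (starRingEnd ℂ) w‖) ^ 2 ≤
      (‖z - w‖ * ‖f z - (starRingEnd ℂ) (f w)‖) ^ 2 :=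
    pow_le_pow_left₀ (by positivity) hS 2
  rw [mul_pow, mul_pow, hn1, hn2] at hS2
  nlinarith

/-- Linear lower bound of the imaginary part. -/
lemma im_lower {f : ℂ → ℂ} (hd : DifferentiableOn ℂ f upperHalf)
    (hm : ∀ z ∈ upperHalf, f z ∈ upperHalf) (x y : ℝ) (hy : 0 < y) (hy1 : y ≤ 1) :
    y * (f (x + Complex.I)).im ≤ (f (x + y * Complex.I)).im := by
  have hz : (x + y * Complex.I : ℂ) ∈ upperHalf := by simp [upperHalf, hy]
  have hw : (x + Complex.I : ℂ) ∈ upperHalf := by simp [upperHalf]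
  have h := schwarz_pick_s19 hd hm hz hw
  set u := f (x + y * Complex.I) with hu
  set v := f (x + Complex.I) with hv
  have hu0 : 0 < u.im := hm _ hz
  have hv0 : 0 < v.im := hm _ hw
  have e1 : ‖(x + y * Complex.I : ℂ) - (x + Complex.I)‖ ^ 2 = (1 - y) ^ 2 := by
    rw [← Complex.normSq_eq_norm_sq]; simp [Complex.normSq_apply]; ring
  have e2 : (u.im - v.im) ^ 2 ≤ ‖u - v‖ ^ 2 := by
    rw [← Complex.normSq_eq_norm_sq]; simp [Complex.normSq_apply]; nlinarith [sq_nonneg (u.re - v.re)]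
  rw [e1] at h
  simp at h
  by_contra hc
  push Not at hc
  -- (u-v)^2 y ≤ (1-y)^2 u v, with u < y v
  have h3 : (u.im - v.im) ^ 2 * y ≤ (1 - y) ^ 2 * (u.im * v.im) := by nlinarith
  have h4 : (u.im - y * v.im) * (y * u.im - v.im) ≤ 0 := by nlinarith
  have h5 : y * u.im - v.im < 0 := by nlinarith
  have h6 : 0 < (y * v.im - u.im) * (v.im - y * u.im) := mul_pos (by linarith) (by linarith)
  nlinarith

/-- A Krein function is either zero or maps the upper half-plane into itself. -/
lemma krein_maps {Z : ℂ → ℂ} (hZ : kreinClass Z) (hne : ∃ z ∈ upperHalf, Z z ≠ 0) :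
    ∀ z ∈ upperHalf, Z z ∈ upperHalf := by
  obtain ⟨hd, hsym, him, hneg, hlim⟩ := hZ
  have hsub : upperHalf ⊆ kreinDomain := fun z hz => Or.inl (ne_of_gt hz)
  have hd' : DifferentiableOn ℂ Z upperHalf := hd.mono hsub
  have hpre : IsPreconnected upperHalf := (convex_halfSpace_im_gt 0).isPreconnected
  rcases (hd'.analyticOnNhd isOpen_uh).is_constant_or_isOpen hpre with ⟨c, hc⟩ | hop
  · -- constant
    exfalso
    have hopen : IsOpen kreinDomain := by
      apply IsOpen.union
      · exact isOpen_ne_fun Complex.continuous_im continuous_const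
      · exact isOpen_lt Complex.continuous_re continuous_const
    have hval : ∀ x : ℝ, 0 < x → Z (-(x : ℂ)) = c := by
      intro x hx
      have hmem : (-(x : ℂ)) ∈ kreinDomain := Or.inr (by simp [hx])
      have hcont : ContinuousAt Z (-(x : ℂ)) :=
        (hd.differentiableAt (hopen.mem_nhds hmem)).continuousAt
      have ht : Tendsto (fun y : ℝ => -(x : ℂ) + y * Complex.I) (𝓝[>] 0) (𝓝 (-(x : ℂ))) := by
        have : Continuous (fun y : ℝ => -(x : ℂ) + y * Complex.I) := by fun_prop
        have := (this.tendsto 0).mono_left (nhdsWithin_le_nhds (s := Ioi 0))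
        simpa using this
      have h1 := hcont.tendsto.comp ht
      have h2 : Tendsto (Z ∘ fun y : ℝ => -(x : ℂ) + y * Complex.I) (𝓝[>] 0) (𝓝 c) := by
        apply tendsto_const_nhds.congr'
        filter_upwards [self_mem_nhdsWithin] with y hy
        simp only [Function.comp]
        rw [hc]
        simpa [upperHalf] using hy
      exact tendsto_nhds_unique h1 h2
    have h3 : Tendsto (fun x : ℝ => Z (-(x : ℂ))) (𝓝[>] 0) (𝓝 c) := by
      apply tendsto_const_nhds.congr'
      filter_upwards [self_mem_nhdsWithin] with y hy
      rw [hval y hy]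
    have h4 := tendsto_nhds_unique h3 hlim
    obtain ⟨z, hz, hz0⟩ := hne
    exact hz0 (by rw [hc z hz, h4])
  · intro z hz
    have ho := hop upperHalf le_rfl isOpen_uh
    by_contra hcon
    have him0 : (Z z).im = 0 := le_antisymm (not_lt.1 hcon) (him z hz)
    have hmem : Z z ∈ Z '' upperHalf := ⟨z, hz, rfl⟩
    obtain ⟨ε, hε, hb⟩ := Metric.isOpen_iff.1 ho _ hmem
    have : Z z - (ε / 2 : ℝ) * Complex.I ∈ Metric.ball (Z z) ε := by
      simp [abs_of_pos hε]; linarith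
    obtain ⟨w, hw, hw'⟩ := hb this
    have := him w hw
    rw [hw'] at this
    simp [him0] at this
    linarith

/-- On the negative axis a nonzero Krein function is strictly negative. -/
lemma krein_neg {Z : ℂ → ℂ} (hZ : kreinClass Z) (hm : ∀ z ∈ upperHalf, Z z ∈ upperHalf) :
    ∀ z ∈ kreinDomain, Z z ∈ kreinDomain := by
  obtain ⟨hd, hsym, him, hneg, hlim⟩ := hZ
  intro z hz
  rcases lt_trichotomy z.im 0 with h | h | h
  · left
    have h1 : (starRingEnd ℂ) z ∈ upperHalf := by simp [upperHalf, h]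
    have h2 : 0 < (Z ((starRingEnd ℂ) z)).im := hm _ h1
    rw [hsym z hz] at h2
    simp at h2; exact ne_of_lt h2
  · right
    have hre : z.re < 0 := by
      rcases hz with h' | h'
      · exact absurd h h'
      · exact h'
    have hzx : z = (z.re : ℂ) := by apply Complex.ext <;> simp [h]
    have hx := hneg z.re hre
    rw [← hzx] at hx
    rcases lt_or_eq_of_le hx.2 with h' | h'
    · exact h'
    · exfalso
      have hz0 : Z z = 0 := by apply Complex.ext <;> simp [hx.1, h']
      -- open mapping on the left half plane
      set U : Set ℂ := {z | z.re < 0} with hU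
      have hUo : IsOpen U := isOpen_lt Complex.continuous_re continuous_const
      have hUs : U ⊆ kreinDomain := fun z hz => Or.inr hz
      have hpre : IsPreconnected U := (convex_halfSpace_re_lt 0).isPreconnected
      rcases ((hd.mono hUs).analyticOnNhd hUo).is_constant_or_isOpen hpre with ⟨c, hc⟩ | hop
      · have h1 := hc z hre
        have h2 := hc (-1 + Complex.I) (by simp [hU])
        have h3 : 0 < (Z (-1 + Complex.I)).im := hm _ (by simp [upperHalf])
        rw [h2, ← h1, hz0] at h3
        simp at h3
      · have ho := hop U le_rfl hUo
        have hmem : Z z ∈ Z '' U := ⟨z, hre, rfl⟩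
        obtain ⟨ε, hε, hb⟩ := Metric.isOpen_iff.1 ho _ hmem
        have : Z z + (ε / 2 : ℝ) ∈ Metric.ball (Z z) ε := by
          simp [abs_of_pos hε]; linarith
        obtain ⟨w, hw, hw'⟩ := hb this
        rw [hz0] at hw'
        have hwre : w.re < 0 := hw
        rcases lt_trichotomy w.im 0 with g | g | g
        · have h1 : (starRingEnd ℂ) w ∈ upperHalf := by simp [upperHalf, g]
          have h2 : 0 < (Z ((starRingEnd ℂ) w)).im := hm _ h1
          rw [hsym w (hUs hw), hw', Complex.conj_im, zero_add, Complex.ofReal_im] at h2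
          simp at h2
        · have hwx : w = (w.re : ℂ) := by apply Complex.ext <;> simp [g]
          have := (hneg w.re hwre).2
          rw [← hwx, hw'] at this
          simp at this; linarith
        · have h2 : 0 < (Z w).im := hm _ g
          rw [hw'] at h2
          simp at h2
  · left
    exact ne_of_gt (hm z h)

/-- Along the imaginary axis, a nonzero Krein function tends to zero at zero. -/
lemma krein_imag {Z : ℂ → ℂ} (hZ : kreinClass Z) (hm : ∀ z ∈ upperHalf, Z z ∈ upperHalf)
    (r : ℝ) (hr : 0 < r) : ‖Z (2 * r ^ 2 * Complex.I)‖ ≤ 16 * ‖Z (-(r ^ 2 : ℝ))‖ := by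
  have hK := krein_neg hZ hm
  have hsl : ∀ z ∈ kreinDomain, -z ∈ Complex.slitPlane := by
    intro z hz
    rw [Complex.mem_slitPlane_iff]
    rcases hz with h | h
    · right; simpa using h
    · left; simpa using h
  have hsq : ∀ z ∈ upperHalf, z ^ 2 ∈ kreinDomain := by
    intro z hz
    have hz' : 0 < z.im := hz
    by_cases h : z.re = 0
    · right; simp [pow_two, h]; positivity
    · left
      have : (z ^ 2).im = 2 * (z.re * z.im) := by simp [pow_two]; ring
      rw [this]
      exact mul_ne_zero two_ne_zero (mul_ne_zero h (ne_of_gt hz'))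
  set f : ℂ → ℂ := fun ζ => Complex.I * Complex.exp (Complex.log (-(Z (ζ ^ 2))) / 2) with hf
  have hnorm : ∀ ζ ∈ upperHalf, ‖f ζ‖ ^ 2 = ‖Z (ζ ^ 2)‖ := by
    intro ζ hζ
    have h0 : -(Z (ζ ^ 2)) ≠ 0 := Complex.slitPlane_ne_zero (hsl _ (hK _ (hsq ζ hζ)))
    rw [← norm_pow]
    have : f ζ ^ 2 = Z (ζ ^ 2) := by
      rw [hf]; simp only
      rw [mul_pow, Complex.I_sq, ← Complex.exp_nat_mul]
      push_cast
      rw [mul_div_cancel₀ _ two_ne_zero, Complex.exp_log h0]; ring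
    rw [this]
  have hfd : DifferentiableOn ℂ f upperHalf := by
    have h1 : DifferentiableOn ℂ (fun ζ => -(Z (ζ ^ 2))) upperHalf :=
      (hZ.1.comp (by fun_prop : DifferentiableOn ℂ (fun ζ : ℂ => ζ ^ 2) upperHalf) hsq).neg
    have h2 := h1.clog (fun ζ hζ => hsl _ (hK _ (hsq ζ hζ)))
    have h3 : DifferentiableOn ℂ (fun ζ => Complex.log (-(Z (ζ ^ 2))) / 2) upperHalf := h2.div_const 2
    exact (h3.cexp).const_mul _
  have hfm : ∀ ζ ∈ upperHalf, f ζ ∈ upperHalf := by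
    intro ζ hζ
    show 0 < (f ζ).im
    rw [hf]; simp only [Complex.I_mul_im]
    rw [Complex.exp_re]
    apply mul_pos (Real.exp_pos _)
    have h1 := hsl _ (hK _ (hsq ζ hζ))
    have h2 : (Complex.log (-(Z (ζ ^ 2))) / 2).im = (-(Z (ζ ^ 2))).arg / 2 := by
      have : (Complex.log (-(Z (ζ ^ 2))) / 2).im = (Complex.log (-(Z (ζ ^ 2)))).im / 2 := by
        simp
      rw [this, Complex.log_im]
    rw [h2]
    have h3 := Complex.mem_slitPlane_iff_arg.1 h1
    have h4 := Complex.neg_pi_lt_arg (-(Z (ζ ^ 2)))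
    have h5 := lt_of_le_of_ne (Complex.arg_le_pi (-(Z (ζ ^ 2)))) h3.1
    apply Real.cos_pos_of_mem_Ioo
    constructor <;> linarith
  have ha : (r + r * Complex.I : ℂ) ∈ upperHalf := by simp [upperHalf, hr]
  have hb : (r * Complex.I : ℂ) ∈ upperHalf := by simp [upperHalf, hr]
  have hS := schwarz_pick_s19 hfd hfm ha hb
  have ea := hnorm _ ha
  have eb := hnorm _ hb
  have e1 : (r + r * Complex.I : ℂ) ^ 2 = 2 * r ^ 2 * Complex.I := by
    linear_combination (r : ℂ) ^ 2 * Complex.I_sq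
  have e2 : (r * Complex.I : ℂ) ^ 2 = -(r ^ 2 : ℝ) := by
    push_cast; linear_combination (r : ℂ) ^ 2 * Complex.I_sq
  rw [e1] at ea
  rw [e2] at eb
  have e3 : (r + r * Complex.I : ℂ) - r * Complex.I = r := by ring
  rw [e3] at hS
  simp at hS
  set A := ‖f (r + r * Complex.I)‖ with hA
  set B := ‖f (r * Complex.I)‖ with hB
  have hrr : 0 < r * r := by positivity
  have i1 : (f (r + r * Complex.I)).im ≤ A := Complex.im_le_norm _
  have i2 : (f (r * Complex.I)).im ≤ B := Complex.im_le_norm _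
  have j1 : 0 < (f (r + r * Complex.I)).im := hfm _ ha
  have j2 : 0 < (f (r * Complex.I)).im := hfm _ hb
  have k1 : ‖f (r + r * Complex.I) - f (r * Complex.I)‖ ^ 2 ≤ A * B := by
    have : (f (r + r * Complex.I)).im * (f (r * Complex.I)).im ≤ A * B :=
      mul_le_mul i1 i2 j2.le (by linarith)
    nlinarith
  have k2 : A - B ≤ ‖f (r + r * Complex.I) - f (r * Complex.I)‖ := norm_sub_norm_le _ _
  have k3 : A ≤ 4 * B := by
    by_contra hc
    push Not at hc
    have : (A - B) ^ 2 ≤ A * B := by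
      have hAB : 0 ≤ A - B := by linarith [norm_nonneg (f (r * Complex.I))]
      nlinarith
    nlinarith [norm_nonneg (f (r * Complex.I))]
  rw [← ea, ← eb]
  nlinarith [norm_nonneg (f (r + r * Complex.I))]

lemma arg_uh {z : ℂ} (hz : z ∈ upperHalf) : 0 < z.arg ∧ z.arg < Real.pi := by
  have hz' : 0 < z.im := hz
  constructor
  · rcases lt_or_eq_of_le (Complex.arg_nonneg_iff.2 hz'.le) with h | h
    · exact h
    · have := (Complex.arg_eq_zero_iff.1 h.symm).2
      linarith
  · exact Complex.arg_lt_pi_iff.2 (Or.inr hz'.ne')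

lemma ne_zero_uh {z : ℂ} (hz : z ∈ upperHalf) : z ≠ 0 := by
  rintro rfl
  simp [upperHalf] at hz

lemma arg_sum {p q r k : ℂ} (hp : p ∈ upperHalf) (hq : q ∈ upperHalf) (hr : r ∈ upperHalf)
    (hk : k ∈ upperHalf) (h : p * q = r * k) : p.arg + q.arg = r.arg + k.arg := by
  have e : Complex.exp (Complex.log p + Complex.log q) =
      Complex.exp (Complex.log r + Complex.log k) := by
    rw [Complex.exp_add, Complex.exp_add, Complex.exp_log (ne_zero_uh hp),
      Complex.exp_log (ne_zero_uh hq), Complex.exp_log (ne_zero_uh hr),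
      Complex.exp_log (ne_zero_uh hk), h]
  obtain ⟨n, hn⟩ := Complex.exp_eq_exp_iff_exists_int.1 e
  have him := congrArg Complex.im hn
  simp [Complex.log_im] at him
  have h1 := arg_uh hp
  have h2 := arg_uh hq
  have h3 := arg_uh hr
  have h4 := arg_uh hk
  have hpi := Real.pi_pos
  have n1 : (n : ℝ) < 1 := by
    by_contra hc
    push Not at hc
    nlinarith
  have n2 : (-1 : ℝ) < n := by
    by_contra hc
    push Not at hc
    nlinarith
  have n3 : n = 0 := by
    have : n < 1 := by exact_mod_cast n1
    have : -1 < n := by exact_mod_cast n2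
    omega
  rw [n3] at him
  simpa using him

lemma log_diff {Z : ℂ → ℂ} (hd : DifferentiableOn ℂ Z upperHalf)
    (hm : ∀ z ∈ upperHalf, Z z ∈ upperHalf) :
    DifferentiableOn ℂ (fun z => Complex.log (Z z)) upperHalf := by
  apply hd.clog
  intro z hz
  exact Complex.mem_slitPlane_iff.2 (Or.inr (ne_of_gt (hm z hz)))

lemma log_maps {Z : ℂ → ℂ} (hm : ∀ z ∈ upperHalf, Z z ∈ upperHalf) :
    ∀ z ∈ upperHalf, Complex.log (Z z) ∈ upperHalf := by
  intro z hz
  show 0 < (Complex.log (Z z)).im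
  rw [Complex.log_im]
  exact (arg_uh (hm z hz)).1

lemma xy_uh (x : ℝ) {y : ℝ} (hy : 0 < y) : (x + y * Complex.I : ℂ) ∈ upperHalf := by
  simp [upperHalf, hy]

lemma tendsto_vert (x : ℝ) :
    Tendsto (fun y : ℝ => (x + y * Complex.I : ℂ)) (𝓝[>] 0) (𝓝 (x : ℂ)) := by
  have : Continuous (fun y : ℝ => (x : ℂ) + y * Complex.I) := by fun_prop
  have := (this.tendsto 0).mono_left (nhdsWithin_le_nhds (s := Ioi 0))
  simpa using this

lemma bdry_local {Z : ℂ → ℂ} (hd : DifferentiableOn ℂ Z upperHalf)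
    (hm : ∀ z ∈ upperHalf, Z z ∈ upperHalf) {X C δ x0 : ℝ} (hC : 0 < C) (hδ : 0 < δ)
    (harg : ∀ x y : ℝ, 0 < x → x ≤ X → 0 < y → y ≤ δ * x →
      (Z (x + y * Complex.I)).arg ≤ C * (y / x)) (hx0 : 0 < x0) :
    ∃ G : ℝ → ℝ, Continuous G ∧ ∀ x ∈ Icc x0 X,
      Tendsto (fun y : ℝ => Z (x + y * Complex.I)) (𝓝[>] 0) (𝓝 ((Real.exp (G x) : ℝ) : ℂ)) := by
  set F : ℂ → ℂ := fun z => Complex.log (Z z) with hF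
  have hFd := log_diff hd hm
  have hFm := log_maps hm
  set S : Set ℂ := {z | x0 ≤ z.re ∧ z.re ≤ X ∧ 0 < z.im ∧ z.im ≤ δ * x0} with hS
  have hbd : ∀ z ∈ S, (F z).im ≤ C / x0 * z.im := by
    intro z hz
    obtain ⟨h1, h2, h3, h4⟩ := hz
    have hre : 0 < z.re := by linarith
    have := harg z.re z.im hre h2 h3 (by nlinarith)
    rw [Complex.re_add_im] at this
    rw [hF]; simp only [Complex.log_im]
    refine this.trans ?_
    have : z.im / z.re ≤ z.im / x0 := div_le_div_of_nonneg_left h3.le hx0 h1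
    calc C * (z.im / z.re) ≤ C * (z.im / x0) := by gcongr
      _ = _ := by ring
  have hL : LipschitzOnWith (Real.toNNReal (C / x0)) (fun z => (F z).re) S := by
    apply LipschitzOnWith.of_dist_le_mul
    intro z hz w hw
    have hzu : z ∈ upperHalf := hz.2.2.1
    have hwu : w ∈ upperHalf := hw.2.2.1
    have hSP := schwarz_pick_s19 hFd hFm hzu hwu
    have b1 := hbd z hz
    have b2 := hbd w hw
    have p1 : 0 < (F z).im := hFm z hzu
    have p2 : 0 < (F w).im := hFm w hwu
    have hzi : 0 < z.im := hzu
    have hwi : 0 < w.im := hwu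
    have hcx : 0 < C / x0 := by positivity
    rw [Real.coe_toNNReal _ hcx.le, Real.dist_eq, dist_eq_norm]
    have e1 : |(F z).re - (F w).re| ≤ ‖F z - F w‖ := by
      rw [← Complex.sub_re]; exact Complex.abs_re_le_norm _
    refine e1.trans ?_
    apply le_of_sq_le_sq _ (by positivity)
    have e2 : (F z).im * (F w).im ≤ (C / x0 * z.im) * (C / x0 * w.im) :=
      mul_le_mul b1 b2 p2.le (by positivity)
    have e3 : ‖F z - F w‖ ^ 2 * (z.im * w.im) ≤ (C / x0 * ‖z - w‖) ^ 2 * (z.im * w.im) := by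
      refine hSP.trans ?_
      calc ‖z - w‖ ^ 2 * ((F z).im * (F w).im)
          ≤ ‖z - w‖ ^ 2 * ((C / x0 * z.im) * (C / x0 * w.im)) := by gcongr
        _ = _ := by ring
    exact le_of_mul_le_mul_right e3 (by positivity)
  obtain ⟨G, hG, hGe⟩ := hL.extend_real
  refine ⟨fun x => G x, hG.continuous.comp Complex.continuous_ofReal, ?_⟩
  intro x hx
  have hxpos : 0 < x := lt_of_lt_of_le hx0 hx.1
  have hev : ∀ᶠ y : ℝ in 𝓝[>] 0, (x + y * Complex.I : ℂ) ∈ S := by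
    have : Ioc (0 : ℝ) (δ * x0) ∈ 𝓝[>] (0 : ℝ) := Ioc_mem_nhdsGT (by positivity)
    filter_upwards [this] with y hy
    refine ⟨?_, ?_, ?_, ?_⟩ <;> simp [hx.1, hx.2, hy.1, hy.2]
  have hre : Tendsto (fun y : ℝ => (F (x + y * Complex.I)).re) (𝓝[>] 0) (𝓝 (G x)) := by
    have h1 := (hG.continuous.tendsto (x : ℂ)).comp (tendsto_vert x)
    apply h1.congr'
    filter_upwards [hev] with y hy
    exact (hGe hy).symm
  have him : Tendsto (fun y : ℝ => (F (x + y * Complex.I)).im) (𝓝[>] 0) (𝓝 0) := by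
    have h2 : Tendsto (fun y : ℝ => C / x0 * y) (𝓝[>] 0) (𝓝 0) := by
      have : Continuous (fun y : ℝ => C / x0 * y) := by fun_prop
      have := (this.tendsto 0).mono_left (nhdsWithin_le_nhds (s := Ioi 0))
      simpa using this
    apply tendsto_of_tendsto_of_tendsto_of_le_of_le' tendsto_const_nhds h2
    · filter_upwards [hev] with y hy
      exact le_of_lt (hFm _ hy.2.2.1)
    · filter_upwards [hev] with y hy
      simpa using hbd _ hy
  have hFt : Tendsto (fun y : ℝ => F (x + y * Complex.I)) (𝓝[>] 0) (𝓝 ((G x : ℝ) : ℂ)) := by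
    have h1 := (Complex.continuous_ofReal.tendsto _).comp hre
    have h2 := ((Complex.continuous_ofReal.tendsto _).comp him).mul_const Complex.I
    have h3 := h1.add h2
    simp only [Complex.ofReal_zero, zero_mul, add_zero] at h3
    apply h3.congr
    intro y
    simp only [Function.comp]
    rw [Complex.re_add_im]
  have hexp := (Complex.continuous_exp.tendsto _).comp hFt
  rw [← Complex.ofReal_exp] at hexp
  apply hexp.congr'
  filter_upwards [hev] with y hy
  simp only [Function.comp, hF]
  rw [Complex.exp_log (ne_zero_uh (hm _ hy.2.2.1))]

/-- The argument bound used throughout. -/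
def ArgBound (Z : ℂ → ℂ) (I : Set ℝ) : Prop :=
  ∀ X ∈ I, ∃ C > 0, ∃ δ > 0, δ ≤ 1 ∧ ∀ x y : ℝ, 0 < x → x ≤ X → 0 < y → y ≤ δ * x →
      (Z (x + y * Complex.I)).arg ≤ C * (y / x)

lemma bdry_global {Z : ℂ → ℂ} (hd : DifferentiableOn ℂ Z upperHalf)
    (hm : ∀ z ∈ upperHalf, Z z ∈ upperHalf) {I : Set ℝ} (hI0 : ∀ x ∈ I, 0 < x)
    (hIl : ∀ x ∈ I, ∀ x', 0 < x' → x' ≤ x → x' ∈ I) (harg : ArgBound Z I) :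
    ∃ g : ℝ → ℝ, (∀ x ∈ I, Tendsto (fun y : ℝ => Z (x + y * Complex.I)) (𝓝[>] 0)
        (𝓝 ((Real.exp (g x) : ℝ) : ℂ))) ∧
      ∀ x0 X, 0 < x0 → X ∈ I → ContinuousOn g (Icc x0 X) := by
  have h1 : ∀ x : ℝ, ∃ ℓ : ℝ, x ∈ I → Tendsto (fun y : ℝ => Z (x + y * Complex.I)) (𝓝[>] 0)
        (𝓝 ((Real.exp ℓ : ℝ) : ℂ)) := by
    intro x
    by_cases hx : x ∈ I
    · obtain ⟨C, hC, δ, hδ, -, hb⟩ := harg x hx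
      obtain ⟨G, -, hG⟩ := bdry_local hd hm hC hδ hb (hI0 x hx)
      exact ⟨G x, fun _ => hG x ⟨le_rfl, le_rfl⟩⟩
    · exact ⟨0, fun h => absurd h hx⟩
  choose g hg using h1
  refine ⟨g, hg, ?_⟩
  intro x0 X hx0 hX
  obtain ⟨C, hC, δ, hδ, -, hb⟩ := harg X hX
  obtain ⟨G, hGc, hG⟩ := bdry_local hd hm hC hδ hb hx0
  apply hGc.continuousOn.congr
  intro x hx
  have hxI : x ∈ I := hIl X hX x (lt_of_lt_of_le hx0 hx.1) hx.2
  have := tendsto_nhds_unique (hg x hxI) (hG x hx)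
  exact Real.exp_injective (Complex.ofReal_injective this)

lemma bdry_zero {Z : ℂ → ℂ} (hZ : kreinClass Z) 
    (hm : ∀ z ∈ upperHalf, Z z ∈ upperHalf) {I : Set ℝ} (hI0 : ∀ x ∈ I, 0 < x)
    (hIl : ∀ x ∈ I, ∀ x', 0 < x' → x' ≤ x → x' ∈ I) (harg : ArgBound Z I) {g : ℝ → ℝ}
    (hg : ∀ x ∈ I, Tendsto (fun y : ℝ => Z (x + y * Complex.I)) (𝓝[>] 0)
        (𝓝 ((Real.exp (g x) : ℝ) : ℂ))) {X : ℝ} (hX : X ∈ I) {ε : ℝ} (hε : 0 < ε) :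
    ∃ x, 0 < x ∧ x ≤ X ∧ Real.exp (g x) < ε := by
  obtain ⟨C, hC, δ, hδ, hδ1, hb⟩ := harg X hX
  have hsub : upperHalf ⊆ kreinDomain := fun z hz => Or.inl (ne_of_gt hz)
  have hd : DifferentiableOn ℂ Z upperHalf := hZ.1.mono hsub
  set F : ℂ → ℂ := fun z => Complex.log (Z z) with hF
  have hFd := log_diff hd hm
  have hFm := log_maps hm
  have hpi := Real.pi_pos
  set M : ℝ := Real.sqrt (2 * C * Real.pi) with hM
  have hXpos := hI0 X hX
  have key : ∀ x, 0 < x → x ≤ X → Real.exp (g x) ≤ Real.exp M * ‖Z (x * Complex.I)‖ := by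
    intro x hx hxX
    have hxI := hIl X hX x hx hxX
    have ht := (hg x hxI).norm
    have e0 : ‖((Real.exp (g x) : ℝ) : ℂ)‖ = Real.exp (g x) := by
      rw [Complex.norm_real, Real.norm_eq_abs, abs_of_pos (Real.exp_pos _)]
    rw [e0] at ht
    apply le_of_tendsto ht
    have : Ioc (0 : ℝ) (δ * x) ∈ 𝓝[>] (0 : ℝ) := Ioc_mem_nhdsGT (by positivity)
    filter_upwards [this] with y hy
    have hyx : y ≤ x := hy.2.trans (by nlinarith)
    have hw : (x * Complex.I : ℂ) ∈ upperHalf := by simp [upperHalf, hx]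
    have hz := xy_uh x hy.1
    have hSP := schwarz_pick_s19 hFd hFm hz hw
    have b1 := hb x y hx hxX hy.1 hy.2
    have b2 := arg_uh (hm _ hw)
    have b3 := arg_uh (hm _ hz)
    simp only [Complex.log_im] at hSP
    have e1 : ‖(x + y * Complex.I : ℂ) - x * Complex.I‖ ^ 2 ≤ 2 * x ^ 2 := by
      rw [← Complex.normSq_eq_norm_sq]; simp [Complex.normSq_apply]; nlinarith [hy.1]
    have e2 : (Z (x + y * Complex.I)).arg * (Z (x * Complex.I)).arg ≤ C * (y / x) * Real.pi :=
      mul_le_mul b1 b2.2.le b2.1.le (by have := hy.1; positivity)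
    have e3 : ‖F (x + y * Complex.I) - F (x * Complex.I)‖ ^ 2 * (y * x)
        ≤ (2 * C * Real.pi) * (y * x) := by
      have i1 : (x + y * Complex.I : ℂ).im = y := by simp
      have i2 : (x * Complex.I : ℂ).im = x := by simp
      rw [i1, i2] at hSP
      refine hSP.trans ?_
      calc _ ≤ (2 * x ^ 2) * (C * (y / x) * Real.pi) := by
            apply mul_le_mul e1 e2 _ (by positivity)
            exact mul_nonneg b3.1.le b2.1.le
        _ = _ := by field_simp
    have e4 : ‖F (x + y * Complex.I) - F (x * Complex.I)‖ ^ 2 ≤ 2 * C * Real.pi :=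
      le_of_mul_le_mul_right e3 (mul_pos hy.1 hx)
    have e5 : ‖F (x + y * Complex.I) - F (x * Complex.I)‖ ≤ M := Real.le_sqrt_of_sq_le e4
    have e6 : (F (x + y * Complex.I)).re - (F (x * Complex.I)).re ≤ M := by
      rw [← Complex.sub_re]; exact (Complex.re_le_norm _).trans e5
    have n1 : ‖Z (x + y * Complex.I)‖ = Real.exp (F (x + y * Complex.I)).re := by
      rw [hF, ← Complex.norm_exp, Complex.exp_log (ne_zero_uh (hm _ hz))]
    have n2 : ‖Z (x * Complex.I)‖ = Real.exp (F (x * Complex.I)).re := by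
      rw [hF, ← Complex.norm_exp, Complex.exp_log (ne_zero_uh (hm _ hw))]
    rw [n1, n2, ← Real.exp_add]
    apply Real.exp_le_exp.2
    linarith
  have hlim := hZ.2.2.2.2
  have hlim0 : ∀ᶠ x : ℝ in 𝓝[>] 0, ‖Z (-(x : ℂ))‖ < ε / (16 * Real.exp M) := by
    have := hlim.norm
    rw [norm_zero] at this
    exact this.eventually (gt_mem_nhds (by positivity))
  have h2 : Ioc (0 : ℝ) (X / 2) ∈ 𝓝[>] (0 : ℝ) := Ioc_mem_nhdsGT (by positivity)
  obtain ⟨t, ht1, ht2⟩ := (hlim0.and h2).exists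
  have ht0 : 0 < t := ht2.1
  have hk := key (2 * t) (by positivity) (by linarith [ht2.2])
  refine ⟨2 * t, by positivity, by linarith [ht2.2], lt_of_le_of_lt hk ?_⟩
  have hr := krein_imag hZ hm (Real.sqrt t) (Real.sqrt_pos.2 ht0)
  rw [Real.sq_sqrt ht0.le, ← Complex.ofReal_pow, Real.sq_sqrt ht0.le] at hr
  push_cast
  rw [lt_div_iff₀ (by positivity)] at ht1
  nlinarith [Real.exp_pos M]

lemma den_im_le (z : ℂ) (hz : z ∈ upperHalf) (t : ℝ) : z.im * |t| ≤ ‖1 - z * (t : ℂ)‖ := by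
  have h := Complex.abs_im_le_norm (1 - z * (t : ℂ))
  have hz' : 0 < z.im := hz
  simp [abs_mul, abs_of_pos hz'] at h
  exact h

lemma den_ne (z : ℂ) (hz : z ∈ upperHalf) (t : ℝ) : 1 - z * (t : ℂ) ≠ 0 := by
  intro h
  have h1 := den_im_le z hz t
  have hz' : 0 < z.im := hz
  rw [h, norm_zero] at h1
  have : t = 0 := by
    by_contra ht
    have : 0 < |t| := abs_pos.2 ht
    nlinarith
  simp [this] at h

lemma psi_integrable {ν : Measure ℝ} [IsProbabilityMeasure ν] {z : ℂ} (hz : z ∈ upperHalf) :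
    Integrable (fun t : ℝ => (z * (t : ℂ)) / (1 - z * (t : ℂ))) ν := by
  have hz' : 0 < z.im := hz
  apply Integrable.of_bound (C := ‖z‖ / z.im)
  · exact (by fun_prop : Measurable (fun t : ℝ => (z * (t : ℂ)) / (1 - z * (t : ℂ)))).aestronglyMeasurable
  · refine Eventually.of_forall fun t => ?_
    have h1 := den_im_le z hz t
    have h2 : 0 < ‖1 - z * (t : ℂ)‖ := norm_pos_iff.2 (den_ne z hz t)
    rw [norm_div, norm_mul, Complex.norm_real, Real.norm_eq_abs, div_le_div_iff₀ h2 hz']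
    nlinarith [norm_nonneg z]

lemma psi_integrand_im (z : ℂ) (t : ℝ) :
    ((z * (t : ℂ)) / (1 - z * (t : ℂ))).im = z.im * (t / ‖1 - z * (t : ℂ)‖ ^ 2) := by
  rw [← Complex.normSq_eq_norm_sq, Complex.div_im]
  simp
  ring

lemma im_integrable {ν : Measure ℝ} [IsProbabilityMeasure ν] {z : ℂ} (hz : z ∈ upperHalf) :
    Integrable (fun t : ℝ => t / ‖1 - z * (t : ℂ)‖ ^ 2) ν := by
  have hz' : 0 < z.im := hz
  have h : Integrable (fun t : ℝ => ((z * (t : ℂ)) / (1 - z * (t : ℂ))).im) ν :=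
    (psi_integrable (ν := ν) hz).im
  have h2 := h.const_mul (z.im)⁻¹
  apply h2.congr
  refine Eventually.of_forall fun t => ?_
  simp only
  rw [psi_integrand_im]
  field_simp

lemma psi_im {ν : Measure ℝ} [IsProbabilityMeasure ν] {z : ℂ} (hz : z ∈ upperHalf) :
    (psiPlus ν z).im = z.im * ∫ t : ℝ, t / ‖1 - z * (t : ℂ)‖ ^ 2 ∂ν := by
  rw [psiPlus, ← integral_const_mul]
  have h : (∫ t : ℝ, (z * (t : ℂ)) / (1 - z * (t : ℂ)) ∂ν).im =
      ∫ t : ℝ, ((z * (t : ℂ)) / (1 - z * (t : ℂ))).im ∂ν :=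
    (integral_im (psi_integrable (ν := ν) hz)).symm
  rw [h]
  congr 1
  ext t
  exact psi_integrand_im z t

lemma MPlus.ae_nonneg {ν : Measure ℝ} (hν : MPlus ν) : ∀ᵐ t ∂ν, 0 ≤ t := by
  rw [ae_iff]
  have : {t : ℝ | ¬ 0 ≤ t} = Iio 0 := by ext t; simp
  rw [this]; exact hν.2.1

lemma psi_im_pos {ν : Measure ℝ} (hν : MPlus ν) {z : ℂ} (hz : z ∈ upperHalf) :
    0 < (psiPlus ν z).im := by
  have := hν.1
  have hz' : 0 < z.im := hz
  rw [psi_im hz]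
  apply mul_pos hz'
  have h0 : 0 ≤ᵐ[ν] fun t : ℝ => t / ‖1 - z * (t : ℂ)‖ ^ 2 := by
    filter_upwards [hν.ae_nonneg] with t ht
    positivity
  rw [integral_pos_iff_support_of_nonneg_ae h0 (im_integrable hz)]
  have hsupp : Function.support (fun t : ℝ => t / ‖1 - z * (t : ℂ)‖ ^ 2) = {0}ᶜ := by
    ext t
    have : ‖1 - z * (t : ℂ)‖ ≠ 0 := norm_ne_zero_iff.2 (den_ne z hz t)
    simp [den_ne z hz t]
  rw [hsupp, prob_compl_eq_one_sub (measurableSet_singleton _)]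
  exact tsub_pos_of_lt hν.2.2

lemma one_add_psi_ne {ν : Measure ℝ} (hν : MPlus ν) {z : ℂ} (hz : z ∈ upperHalf) :
    1 + psiPlus ν z ≠ 0 := by
  intro h
  have h1 := congrArg Complex.im h
  have h2 := psi_im_pos hν hz
  simp at h1; linarith

lemma K_mul {ν : Measure ℝ} (hν : MPlus ν) {z : ℂ} (hz : z ∈ upperHalf) :
    (1 - KPlus ν z) * (1 + psiPlus ν z) = 1 := by
  have := one_add_psi_ne hν hz
  rw [KPlus]; field_simp; ring

lemma K_uh {ν : Measure ℝ} (hν : MPlus ν) {z : ℂ} (hz : z ∈ upperHalf) :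
    KPlus ν z ∈ upperHalf := by
  have h1 := one_add_psi_ne hν hz
  have h2 := psi_im_pos hν hz
  have h3 : 0 < Complex.normSq (1 + psiPlus ν z) := Complex.normSq_pos.2 h1
  show 0 < (KPlus ν z).im
  have : (KPlus ν z).im = (psiPlus ν z).im / Complex.normSq (1 + psiPlus ν z) := by
    rw [KPlus, Complex.div_im]
    simp
    field_simp
    ring
  rw [this]; positivity

lemma psi_im_eq {ν : Measure ℝ} (hν : MPlus ν) {z : ℂ} (hz : z ∈ upperHalf) :
    (psiPlus ν z).im = (KPlus ν z).im / ‖1 - KPlus ν z‖ ^ 2 := by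
  have h := K_mul hν hz
  have hne : 1 - KPlus ν z ≠ 0 := left_ne_zero_of_mul_eq_one h
  have h2 : psiPlus ν z = (1 - KPlus ν z)⁻¹ - 1 := by
    field_simp
    linear_combination h
  rw [← Complex.normSq_eq_norm_sq]
  rw [h2, Complex.sub_im, Complex.inv_im]
  simp

lemma supp_of {ν : Measure ℝ} (hν : MPlus ν) (c : ℝ)
    (h : ∀ t > 0, t ≠ c → ∃ B : ℝ, ∃ w : ℝ → ℂ,
      (∀ᶠ y in 𝓝[>] (0 : ℝ), w y ∈ upperHalf) ∧ Tendsto w (𝓝[>] 0) (𝓝 ((t⁻¹ : ℝ) : ℂ)) ∧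
      ∀ᶠ y in 𝓝[>] (0 : ℝ), ∫ t : ℝ, t / ‖1 - w y * (t : ℂ)‖ ^ 2 ∂ν ≤ B) :
    ∀ᵐ t ∂ν, t = 0 ∨ t = c := by
  have := hν.1
  have hB := Besicovitch.ae_tendsto_rnDeriv (volume : Measure ℝ) ν
  have hfin := Measure.rnDeriv_lt_top (volume : Measure ℝ) ν
  filter_upwards [hB, hfin, hν.ae_nonneg] with t0 ht hlt ht0
  by_contra hcon
  push Not at hcon
  have htpos : 0 < t0 := lt_of_le_of_ne ht0 (Ne.symm hcon.1)
  obtain ⟨B, w, hw1, hw2, hw3⟩ := h t0 htpos hcon.2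
  set s := t0⁻¹ with hs
  have hspos : 0 < s := inv_pos.2 htpos
  set κ : ℝ := (t0 / 2) / (s + 2 * t0) ^ 2 with hκ
  have hκpos : 0 < κ := by positivity
  have key : ∀ᶠ r in 𝓝[>] (0 : ℝ), ν (Metric.closedBall t0 r) ≤
      ENNReal.ofReal ((|B| + 1) / κ * r ^ 2) := by
    have : Ioo (0 : ℝ) (t0 / 2) ∈ 𝓝[>] (0 : ℝ) := Ioo_mem_nhdsGT (by positivity)
    filter_upwards [this] with r hr
    have hw4 : ∀ᶠ y in 𝓝[>] (0 : ℝ), ‖w y - s‖ < r := by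
      have := hw2.eventually (Metric.ball_mem_nhds _ hr.1)
      filter_upwards [this] with y hy
      simpa [dist_eq_norm] using hy
    obtain ⟨y, ⟨hy1, hy3⟩, hy4⟩ := ((hw1.and hw3).and hw4).exists
    have hr0 := hr.1
    have hsub : Metric.closedBall t0 r ⊆ {t : ℝ | κ / r ^ 2 ≤ t / ‖1 - w y * (t : ℂ)‖ ^ 2} := by
      intro t ht
      rw [Metric.mem_closedBall, Real.dist_eq] at ht
      have habs := abs_le.1 ht
      have t1 : t0 / 2 ≤ t := by linarith [hr.2]
      have t2 : t ≤ 2 * t0 := by linarith [hr.2]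
      have hn : ‖1 - w y * (t : ℂ)‖ ≤ (s + 2 * t0) * r := by
        have e : 1 - w y * (t : ℂ) = ((s * (t0 - t) : ℝ) : ℂ) - (w y - s) * t := by
          have : ((s * t0 : ℝ) : ℂ) = 1 := by rw [hs, inv_mul_cancel₀ htpos.ne']; simp
          push_cast at this ⊢
          linear_combination -this
        rw [e]
        refine (norm_sub_le _ _).trans ?_
        rw [Complex.norm_real, norm_mul (w y - (s : ℂ)), Complex.norm_real, Real.norm_eq_abs,
          Real.norm_eq_abs, abs_mul, abs_of_pos hspos, abs_sub_comm, abs_of_pos (by linarith : 0 < t)]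
        have g1 : ‖w y - s‖ * t ≤ r * (2 * t0) :=
          mul_le_mul hy4.le t2 (by linarith) hr0.le
        nlinarith
      have hnpos : 0 < ‖1 - w y * (t : ℂ)‖ := norm_pos_iff.2 (den_ne _ hy1 t)
      show κ / r ^ 2 ≤ t / ‖1 - w y * (t : ℂ)‖ ^ 2
      calc κ / r ^ 2 = (t0 / 2) / ((s + 2 * t0) * r) ^ 2 := by rw [hκ]; field_simp
        _ ≤ t / ‖1 - w y * (t : ℂ)‖ ^ 2 := by
          apply div_le_div₀ (by linarith) t1 (by positivity)
          gcongr
    have h0 : 0 ≤ᵐ[ν] fun t : ℝ => t / ‖1 - w y * (t : ℂ)‖ ^ 2 := by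
      filter_upwards [hν.ae_nonneg] with t ht
      positivity
    have hmk := mul_meas_ge_le_integral_of_nonneg h0 (im_integrable hy1) (κ / r ^ 2)
    have hreal : ν.real (Metric.closedBall t0 r) ≤ (|B| + 1) / κ * r ^ 2 := by
      have m1 : ν.real (Metric.closedBall t0 r) ≤ ν.real {t : ℝ | κ / r ^ 2 ≤ t / ‖1 - w y * (t : ℂ)‖ ^ 2} :=
        measureReal_mono hsub
      have m2 : κ / r ^ 2 * ν.real (Metric.closedBall t0 r) ≤ |B| + 1 := by
        calc _ ≤ κ / r ^ 2 * ν.real {t : ℝ | κ / r ^ 2 ≤ t / ‖1 - w y * (t : ℂ)‖ ^ 2} := by gcongr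
          _ ≤ _ := hmk.trans (hy3.trans (by linarith [le_abs_self B]))
      have : ν.real (Metric.closedBall t0 r) = (κ / r ^ 2 * ν.real (Metric.closedBall t0 r)) / κ * r ^ 2 := by
        field_simp
      rw [this]; gcongr
    rw [← ofReal_measureReal]
    exact ENNReal.ofReal_le_ofReal hreal
  set A := (|B| + 1) / κ with hA
  have hApos : 0 < A := by positivity
  have htop : Tendsto (fun r => (volume : Measure ℝ) (Metric.closedBall t0 r) / ν (Metric.closedBall t0 r))
      (𝓝[>] 0) (𝓝 ⊤) := by
    have h1 : Tendsto (fun r : ℝ => ENNReal.ofReal ((2 / A) * r⁻¹)) (𝓝[>] 0) (𝓝 ⊤) := by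
      apply ENNReal.tendsto_ofReal_atTop.comp
      exact tendsto_inv_nhdsGT_zero.const_mul_atTop (by positivity)
    apply tendsto_nhds_top_mono h1
    filter_upwards [key, self_mem_nhdsWithin] with r hr hr0
    have hr0' : 0 < r := hr0
    rw [Real.volume_closedBall]
    calc ENNReal.ofReal ((2 / A) * r⁻¹) = ENNReal.ofReal (2 * r / (A * r ^ 2)) := by
          congr 1; field_simp
      _ = ENNReal.ofReal (2 * r) / ENNReal.ofReal (A * r ^ 2) :=
          ENNReal.ofReal_div_of_pos (by positivity)
      _ ≤ _ := ENNReal.div_le_div_left hr _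
  have := tendsto_nhds_unique htop ht
  rw [← this] at hlt
  exact lt_irrefl _ hlt

lemma dirac_of {ν : Measure ℝ} (hν : MPlus ν) {c : ℝ} (hc : 0 < c)
    (hs : ∀ᵐ t ∂ν, t = 0 ∨ t = c)
    (h : ∀ s > 0, ∃ k : ℂ, ∃ w : ℝ → ℂ,
      (∀ᶠ y in 𝓝[>] (0 : ℝ), w y ∈ upperHalf) ∧ Tendsto w (𝓝[>] 0) (𝓝 ((s : ℝ) : ℂ)) ∧
      Tendsto (fun y => KPlus ν (w y)) (𝓝[>] 0) (𝓝 k)) : ν = Measure.dirac c := by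
  have := hν.1
  set m := ν.real {c} with hm
  have hψ : ∀ z : ℂ, psiPlus ν z = m * (z * c / (1 - z * c)) := by
    intro z
    rw [psiPlus]
    have : (fun t : ℝ => (z * (t : ℂ)) / (1 - z * (t : ℂ))) =ᵐ[ν]
        ({c} : Set ℝ).indicator (fun _ => z * c / (1 - z * c)) := by
      filter_upwards [hs] with t ht
      rcases ht with rfl | rfl
      · simp [hc.ne]
      · simp
    rw [integral_congr_ae this, integral_indicator_const _ (measurableSet_singleton c)]
    simp [hm]
  have hmle : m ≤ 1 := measureReal_le_one
  have hm0 : 0 < m := by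
    have hpos := psi_im_pos hν (show Complex.I ∈ upperHalf by simp [upperHalf])
    rw [hψ] at hpos
    rcases lt_or_eq_of_le (measureReal_nonneg : 0 ≤ ν.real {c}) with h' | h'
    · exact h'
    · rw [hm, ← h'] at hpos; simp at hpos
  have hm1 : m = 1 := by
    by_contra hne
    have hlt : m < 1 := lt_of_le_of_ne hmle hne
    have hq : 0 < 1 - m := by linarith
    obtain ⟨k, w, hw1, hw2, hw3⟩ := h (1 / ((1 - m) * c)) (by positivity)
    set s := 1 / ((1 - m) * c) with hs'
    have hsc : s * c = 1 / (1 - m) := by rw [hs']; field_simp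
    have hne : (1 - (s : ℂ) * c) ≠ 0 := by
      have : (1 - s * c) ≠ 0 := by
        rw [hsc]
        have : 1 < 1 / (1 - m) := by rw [lt_div_iff₀ hq]; linarith
        linarith
      exact_mod_cast this
    have hlim : Tendsto (fun y => 1 + psiPlus ν (w y)) (𝓝[>] 0) (𝓝 0) := by
      have h1 : ContinuousAt (fun z : ℂ => 1 + m * (z * c / (1 - z * c))) s := by
        apply ContinuousAt.add continuousAt_const
        apply ContinuousAt.mul continuousAt_const
        exact ContinuousAt.div (by fun_prop) (by fun_prop) hne
      have h2 := h1.tendsto.comp hw2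
      have h3 : (1 + m * ((s : ℂ) * c / (1 - s * c))) = 0 := by
        have : (1 + m * (s * c / (1 - s * c))) = 0 := by
          rw [hsc]
          have : (1 - 1 / (1 - m)) = -m / (1 - m) := by field_simp; ring
          rw [this]; field_simp; ring
        exact_mod_cast this
      rw [h3] at h2
      refine h2.congr fun y => ?_
      simp [hψ]
    have hprod := ((tendsto_const_nhds (x := (1 : ℂ))).sub hw3).mul hlim
    rw [mul_zero] at hprod
    have hone : Tendsto (fun y => (1 - KPlus ν (w y)) * (1 + psiPlus ν (w y))) (𝓝[>] 0) (𝓝 1) := by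
      apply tendsto_const_nhds.congr'
      filter_upwards [hw1] with y hy
      rw [K_mul hν hy]
    exact zero_ne_one (tendsto_nhds_unique hprod hone)
  have hν1 : ν {c} = 1 := by
    have := ofReal_measureReal (μ := ν) (s := {c})
    rw [← this, ← hm, hm1]; simp
  have hν0 : ν {c}ᶜ = 0 := by
    rw [prob_compl_eq_one_sub (measurableSet_singleton _), hν1]; simp
  ext A hA
  rw [Measure.dirac_apply' _ hA]
  by_cases hcA : c ∈ A
  · simp [hcA]
    apply le_antisymm prob_le_one
    rw [← hν1]
    exact measure_mono (by simpa using hcA)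
  · simp [hcA]
    exact measure_mono_null (by intro x hx; simp; rintro rfl; exact hcA hx) hν0

lemma core_dirac_s19 {ν μ : Measure ℝ} (hν : MPlus ν) {Z : ℂ → ℂ}
    (hd : DifferentiableOn ℂ Z upperHalf) (hm : ∀ z ∈ upperHalf, Z z ∈ upperHalf)
    (hK : ∀ z ∈ upperHalf, KPlus ν (Z z) = KPlus μ z) {xb : ℝ} {I : Set ℝ} {g : ℝ → ℝ}
    (hg : ∀ x ∈ I, Tendsto (fun y : ℝ => Z (x + y * Complex.I)) (𝓝[>] 0)
        (𝓝 ((Real.exp (g x) : ℝ) : ℂ)))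
    (hsurj : ∀ s > 0, ∃ x ∈ I, Real.exp (g x) = s)
    (hKμ : ∀ x ∈ I, ∃ k : ℂ, Tendsto (fun y : ℝ => KPlus μ (x + y * Complex.I)) (𝓝[>] 0) (𝓝 k) ∧
      (x ≠ xb → k ≠ 1) ∧
      ∃ B : ℝ, ∀ᶠ y : ℝ in 𝓝[>] 0, (KPlus μ (x + y * Complex.I)).im ≤ B * y) :
    ν = Measure.dirac (Real.exp (g xb))⁻¹ := by
  have := hν.1
  have hev : ∀ x : ℝ, ∀ᶠ y : ℝ in 𝓝[>] 0, Z (x + y * Complex.I) ∈ upperHalf := by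
    intro x
    filter_upwards [self_mem_nhdsWithin] with y hy
    exact hm _ (xy_uh x hy)
  apply dirac_of hν (by positivity)
  · apply supp_of hν
    intro t ht htc
    obtain ⟨x, hx, hxs⟩ := hsurj t⁻¹ (inv_pos.2 ht)
    have hxb : x ≠ xb := by
      rintro rfl
      apply htc
      rw [hxs, inv_inv]
    obtain ⟨k, hk1, hk2, B, hB⟩ := hKμ x hx
    have hk := hk2 hxb
    have hkpos : 0 < ‖1 - k‖ := norm_pos_iff.2 (sub_ne_zero.2 (Ne.symm hk))
    set v := (Z (x + Complex.I)).im with hv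
    have hvpos : 0 < v := hm _ (by simp [upperHalf])
    refine ⟨|B| / ((‖1 - k‖ / 2) ^ 2 * v), fun y => Z (x + y * Complex.I), hev x, ?_, ?_⟩
    · have := hg x hx
      rwa [hxs] at this
    · have h1 : ∀ᶠ y : ℝ in 𝓝[>] 0, ‖1 - k‖ / 2 < ‖1 - KPlus μ (x + y * Complex.I)‖ := by
        have := ((tendsto_const_nhds (x := (1 : ℂ))).sub hk1).norm
        exact this.eventually (lt_mem_nhds (by linarith))
      have h2 : Ioc (0 : ℝ) 1 ∈ 𝓝[>] (0 : ℝ) := Ioc_mem_nhdsGT one_pos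
      filter_upwards [h1, h2, hB] with y hy1 hy2 hy3
      have hzu := xy_uh x hy2.1
      have hwu := hm _ hzu
      have hwpos : 0 < (Z (x + y * Complex.I)).im := hwu
      have e1 := psi_im (ν := ν) hwu
      rw [psi_im_eq hν hwu, hK _ hzu] at e1
      have e2 := im_lower hd hm x y hy2.1 hy2.2
      have e3 : ∫ t : ℝ, t / ‖1 - Z (x + y * Complex.I) * (t : ℂ)‖ ^ 2 ∂ν =
          (KPlus μ (x + y * Complex.I)).im / ‖1 - KPlus μ (x + y * Complex.I)‖ ^ 2 /
            (Z (x + y * Complex.I)).im := by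
        rw [e1]; field_simp
      rw [e3, div_div]
      have hy0 := hy2.1
      calc _ ≤ (|B| * y) / ((‖1 - k‖ / 2) ^ 2 * (y * v)) := by
            apply div_le_div₀ (by positivity)
            · exact hy3.trans (by gcongr; exact le_abs_self B)
            · positivity
            · gcongr
        _ = _ := by field_simp
  · intro s hs
    obtain ⟨x, hx, hxs⟩ := hsurj s hs
    obtain ⟨k, hk1, -⟩ := hKμ x hx
    refine ⟨k, fun y => Z (x + y * Complex.I), hev x, ?_, ?_⟩
    · have := hg x hx
      rwa [hxs] at this
    · apply hk1.congr'
      filter_upwards [self_mem_nhdsWithin] with y hy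
      rw [hK _ (xy_uh x hy)]

lemma analytic_lip {Q : ℂ → ℂ} {X : ℝ} (hQ : ∀ x ∈ Icc 0 X, AnalyticAt ℂ Q ((x : ℝ) : ℂ)) :
    ∃ L > 0, ∃ δ > 0, ∀ x ∈ Icc 0 X, ∀ y : ℝ, 0 < y → y ≤ δ →
      ‖Q (x + y * Complex.I) - Q x‖ ≤ L * y := by
  apply isCompact_Icc.induction_on (p := fun s : Set ℝ => ∃ L : ℝ, L > 0 ∧ ∃ δ : ℝ, δ > 0 ∧ ∀ x ∈ s,
    ∀ y : ℝ, 0 < y → y ≤ δ → ‖Q ((x : ℂ) + y * Complex.I) - Q (x : ℂ)‖ ≤ L * y)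
  · exact ⟨1, one_pos, 1, one_pos, by simp⟩
  · rintro s t hst ⟨L, hL, δ, hδ, h⟩
    exact ⟨L, hL, δ, hδ, fun x hx => h x (hst hx)⟩
  · rintro s t ⟨L, hL, δ, hδ, h⟩ ⟨L', hL', δ', hδ', h'⟩
    refine ⟨max L L', lt_max_of_lt_left hL, min δ δ', lt_min hδ hδ', ?_⟩
    intro x hx y hy hyd
    rcases hx with hx | hx
    · refine (h x hx y hy (hyd.trans (min_le_left _ _))).trans ?_
      gcongr; exact le_max_left _ _
    · refine (h' x hx y hy (hyd.trans (min_le_right _ _))).trans ?_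
      gcongr; exact le_max_right _ _
  · intro x0 hx0
    have hcd : ContDiffAt ℂ 1 Q (x0 : ℂ) := (hQ x0 hx0).contDiffAt
    obtain ⟨K, t, ht, hlip⟩ := hcd.exists_lipschitzOnWith
    obtain ⟨r, hr, hball⟩ := Metric.mem_nhds_iff.1 ht
    refine ⟨Metric.ball x0 (r / 2), mem_nhdsWithin_of_mem_nhds (Metric.ball_mem_nhds _ (by positivity)),
      K + 1, by positivity, r / 4, by positivity, ?_⟩
    intro x hx y hy hyr
    have hx' : ‖(x : ℂ) - x0‖ < r / 2 := by
      rw [Metric.mem_ball, Real.dist_eq] at hx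
      rw [← Complex.ofReal_sub, Complex.norm_real]
      exact hx
    have m1 : (x : ℂ) ∈ t := hball (by rw [Metric.mem_ball, dist_eq_norm]; linarith)
    have hyn : ‖(y * Complex.I : ℂ)‖ = y := by simp [abs_of_pos hy]
    have m2 : (x + y * Complex.I : ℂ) ∈ t := hball (by
      rw [Metric.mem_ball, dist_eq_norm]
      have : (x + y * Complex.I : ℂ) - x0 = (x - x0) + y * Complex.I := by ring
      rw [this]
      refine (norm_add_le _ _).trans_lt ?_
      rw [hyn]; linarith)
    have := hlip.dist_le_mul _ m2 _ m1
    rw [dist_eq_norm, dist_eq_norm] at this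
    have e : (x + y * Complex.I : ℂ) - x = y * Complex.I := by ring
    rw [e, hyn] at this
    refine this.trans ?_
    nlinarith

lemma arg_le_div {z : ℂ} (hre : 0 < z.re) (him : 0 ≤ z.im) : z.arg ≤ z.im / z.re := by
  rw [← Complex.tan_arg]
  apply Real.le_tan (Complex.arg_nonneg_iff.2 him)
  have := Complex.abs_arg_lt_pi_div_two_iff.2 (Or.inl hre)
  exact (abs_lt.1 this).2

/-- Uniform estimates for `z * Q z` near `(0, X]`. -/
lemma zQ_bounds {Q : ℂ → ℂ} {q : ℝ → ℝ} {X : ℝ} (hX : 0 < X)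
    (hQ : ∀ x ∈ Icc 0 X, AnalyticAt ℂ Q ((x : ℝ) : ℂ) ∧ Q x = q x ∧ 0 < q x) :
    ∃ C > 0, ∃ c > 0, ∃ δ > 0, δ ≤ 1 ∧ ∀ x y : ℝ, 0 < x → x ≤ X → 0 < y → y ≤ δ * x →
      ((x + y * Complex.I : ℂ) * Q (x + y * Complex.I)).im ≤ C * y ∧
      c * x ≤ ((x + y * Complex.I : ℂ) * Q (x + y * Complex.I)).re := by
  obtain ⟨L, hL, δ0, hδ0, hlip⟩ := analytic_lip (fun x hx => (hQ x hx).1)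
  have hcont : ContinuousOn q (Icc 0 X) := by
    have h1 : ContinuousOn (fun x : ℝ => (Q x).re) (Icc 0 X) := by
      intro x hx
      have h2 : ContinuousAt (fun x : ℝ => Q x) x :=
        ContinuousAt.comp (f := fun x : ℝ => (x : ℂ)) (hQ x hx).1.continuousAt
          Complex.continuous_ofReal.continuousAt
      exact (Complex.continuous_re.continuousAt.comp h2).continuousWithinAt
    apply h1.congr
    intro x hx
    simp [(hQ x hx).2.1]
  have hne : (Icc 0 X).Nonempty := ⟨0, le_rfl, hX.le⟩
  obtain ⟨x1, hx1, hmin⟩ := isCompact_Icc.exists_isMinOn hne hcont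
  obtain ⟨x2, hx2, hmax⟩ := isCompact_Icc.exists_isMaxOn hne hcont
  set κ := q x1 with hκ
  set M := q x2 with hM
  have hκpos : 0 < κ := (hQ x1 hx1).2.2
  have hMpos : 0 < M := (hQ x2 hx2).2.2
  set δ := min (min 1 (δ0 / X)) (κ / (4 * L * X)) with hδ
  have hδpos : 0 < δ := by positivity
  refine ⟨X * L + M + L * X, by positivity, κ / 2, by positivity, δ, hδpos,
    (min_le_left _ _).trans (min_le_left _ _), ?_⟩
  intro x y hx hxX hy hyd
  have hδ1 : δ ≤ 1 := (min_le_left _ _).trans (min_le_left _ _)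
  have hδ2 : δ ≤ δ0 / X := (min_le_left _ _).trans (min_le_right _ _)
  have hδ3 : δ ≤ κ / (4 * L * X) := min_le_right _ _
  have y1 : y ≤ x := by nlinarith
  have y2 : y ≤ δ0 := by
    calc y ≤ δ * X := hyd.trans (by gcongr)
      _ ≤ δ0 / X * X := by gcongr
      _ = δ0 := by field_simp
  have y3 : L * y ≤ κ / 4 := by
    calc L * y ≤ L * (δ * X) := by gcongr; exact hyd.trans (by gcongr)
      _ ≤ L * (κ / (4 * L * X) * X) := by gcongr
      _ = κ / 4 := by field_simp
  have hxm : x ∈ Icc 0 X := ⟨hx.le, hxX⟩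
  have hl := hlip x hxm y hy y2
  rw [(hQ x hxm).2.1] at hl
  set W := Q (x + y * Complex.I) with hW
  have r1 := (Complex.abs_re_le_norm (W - q x)).trans hl
  have i1 := (Complex.abs_im_le_norm (W - q x)).trans hl
  simp at r1 i1
  rw [abs_le] at r1 i1
  have q1 : κ ≤ q x := hmin hxm
  have q2 : q x ≤ M := hmax hxm
  constructor
  · simp
    nlinarith [mul_le_mul_of_nonneg_left i1.2 hx.le, mul_le_mul_of_nonneg_left r1.2 hy.le,
      mul_pos hL hy, mul_le_mul_of_nonneg_right hxX (mul_pos hL hy).le,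
      mul_le_mul_of_nonneg_right (y1.trans hxX) (mul_pos hL hy).le]
  · simp
    nlinarith [mul_le_mul_of_nonneg_left r1.1 hx.le, mul_le_mul_of_nonneg_left i1.2 hy.le,
      mul_le_mul_of_nonneg_left y3 hx.le, mul_le_mul_of_nonneg_left q1 hx.le,
      mul_le_mul_of_nonneg_left y3 hy.le]

lemma den_re_le {a ρ : ℝ} (ha : 0 < a) (hρ : ρ ≤ 1 / a) {z : ℂ} (hz : z.re ≤ 1 / a - ρ)
    {t : ℝ} (ht : t ∈ Icc 0 a) : a * ρ ≤ ‖1 - z * (t : ℂ)‖ := by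
  have h1 := Complex.re_le_norm (1 - z * (t : ℂ))
  simp only [Complex.sub_re, Complex.one_re, Complex.mul_re, Complex.ofReal_re,
    Complex.ofReal_im, mul_zero, sub_zero] at h1
  refine le_trans ?_ h1
  have e : a * (1 / a) = 1 := by field_simp
  have h2 : z.re * t ≤ (1 / a - ρ) * t := mul_le_mul_of_nonneg_right hz ht.1
  have h3 : (1 / a - ρ) * t ≤ (1 / a - ρ) * a := mul_le_mul_of_nonneg_left ht.2 (by linarith)
  nlinarith

lemma den_re_ne {a : ℝ} (ha : 0 < a) {z : ℂ} (hz : z.re < 1 / a)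
    {t : ℝ} (ht : t ∈ Icc 0 a) : (1 - z * (t : ℂ)) ≠ 0 := by
  have ha' : 0 < 1 / a := by positivity
  have h := den_re_le (ρ := min (1 / a) (1 / a - z.re)) ha (min_le_left _ _) (z := z)
    (by linarith [min_le_right (1 / a) (1 / a - z.re)]) ht
  have h2 : 0 < min (1 / a) (1 / a - z.re) := lt_min ha' (by linarith)
  intro h3
  rw [h3, norm_zero] at h
  nlinarith

noncomputable def Efun (μ : Measure ℝ) (a : ℝ) (z : ℂ) : ℂ :=
  ∫ t in Icc 0 a, (t : ℂ) / (1 - z * (t : ℂ)) ∂μ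

lemma E_integrable {μ : Measure ℝ} [IsProbabilityMeasure μ] {a : ℝ} (ha : 0 < a) {z : ℂ}
    (hz : z.re < 1 / a) :
    Integrable (fun t : ℝ => (t : ℂ) / (1 - z * (t : ℂ))) (μ.restrict (Icc 0 a)) := by
  have ha' : 0 < 1 / a := by positivity
  have h2 : 0 < min (1 / a) (1 / a - z.re) := lt_min ha' (by linarith)
  apply Integrable.of_bound (C := a / (a * min (1 / a) (1 / a - z.re)))
  · exact (by fun_prop : Measurable (fun t : ℝ => (t : ℂ) / (1 - z * (t : ℂ)))).aestronglyMeasurable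
  · filter_upwards [ae_restrict_mem measurableSet_Icc] with t ht
    have h := den_re_le (ρ := min (1 / a) (1 / a - z.re)) ha (min_le_left _ _) (z := z)
      (by linarith [min_le_right (1 / a) (1 / a - z.re)]) ht
    rw [norm_div, Complex.norm_real, Real.norm_eq_abs, abs_of_nonneg ht.1]
    gcongr
    exact ht.2

lemma E_diff {μ : Measure ℝ} [IsProbabilityMeasure μ] {a : ℝ} (ha : 0 < a) {z : ℂ}
    (hz : z.re < 1 / a) : DifferentiableAt ℂ (Efun μ a) z := by
  have ha' : 0 < 1 / a := by positivity
  set ρ := min (1 / a) (1 / a - z.re) / 2 with hρ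
  have h2 : 0 < min (1 / a) (1 / a - z.re) := lt_min ha' (by linarith)
  have hρ0 : 0 < ρ := by positivity
  have h3 := min_le_left (1 / a) (1 / a - z.re)
  have h4 := min_le_right (1 / a) (1 / a - z.re)
  have hopen : IsOpen {w : ℂ | w.re < 1 / a - ρ} := isOpen_lt Complex.continuous_re continuous_const
  have key := hasDerivAt_integral_of_dominated_loc_of_deriv_le (μ := μ.restrict (Icc 0 a))
    (F := fun (w : ℂ) (t : ℝ) => (t : ℂ) / (1 - w * (t : ℂ)))
    (F' := fun (w : ℂ) (t : ℝ) => (t : ℂ) ^ 2 / (1 - w * (t : ℂ)) ^ 2)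
    (x₀ := z) (s := {w : ℂ | w.re < 1 / a - ρ}) (bound := fun _ => a ^ 2 / (a * ρ) ^ 2)
    (hopen.mem_nhds (by show z.re < 1 / a - ρ; linarith))
    (Eventually.of_forall fun w =>
      (by fun_prop : Measurable (fun t : ℝ => (t : ℂ) / (1 - w * (t : ℂ)))).aestronglyMeasurable)
    (E_integrable ha hz)
    ((by fun_prop : Measurable (fun t : ℝ => (t : ℂ) ^ 2 / (1 - z * (t : ℂ)) ^ 2)).aestronglyMeasurable)
    (by
      filter_upwards [ae_restrict_mem measurableSet_Icc] with t ht w hw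
      have h := den_re_le (ρ := ρ) ha (by linarith) (z := w) (le_of_lt hw) ht
      rw [norm_div, norm_pow, norm_pow, Complex.norm_real, Real.norm_eq_abs, abs_of_nonneg ht.1]
      have := ht.1
      gcongr
      exact ht.2)
    (integrable_const _)
    (by
      filter_upwards [ae_restrict_mem measurableSet_Icc] with t ht w hw
      have hw' : w.re < 1 / a - ρ := hw
      have hne := den_re_ne ha (z := w) (by linarith) ht
      have d1 : HasDerivAt (fun w : ℂ => 1 - w * (t : ℂ)) (-(t : ℂ)) w := by
        simpa using ((hasDerivAt_id w).mul_const (t : ℂ)).const_sub 1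
      have d2 := (hasDerivAt_const w (t : ℂ)).div d1 hne
      refine HasDerivAt.congr_deriv d2 ?_
      simp only [zero_mul, zero_sub]
      congr 1
      ring)
  exact key.2.differentiableAt

lemma E_analytic {μ : Measure ℝ} [IsProbabilityMeasure μ] {a : ℝ} (ha : 0 < a) {z : ℂ}
    (hz : z.re < 1 / a) : AnalyticAt ℂ (Efun μ a) z := by
  have hopen : IsOpen {w : ℂ | w.re < 1 / a} := isOpen_lt Complex.continuous_re continuous_const
  have : DifferentiableOn ℂ (Efun μ a) {w : ℂ | w.re < 1 / a} :=
    fun w hw => (E_diff ha hw).differentiableWithinAt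
  exact this.analyticAt (hopen.mem_nhds hz)

noncomputable def efun (μ : Measure ℝ) (a : ℝ) (x : ℝ) : ℝ :=
  ∫ t in Icc 0 a, t / (1 - x * t) ∂μ

lemma E_real {μ : Measure ℝ} {a : ℝ} (x : ℝ) : Efun μ a x = efun μ a x := by
  rw [Efun, efun, ← integral_complex_ofReal]
  congr 1
  ext t
  push_cast
  rfl

lemma e_integrable {μ : Measure ℝ} [IsProbabilityMeasure μ] {a : ℝ} (ha : 0 < a) {x : ℝ}
    (hx : x < 1 / a) : Integrable (fun t : ℝ => t / (1 - x * t)) (μ.restrict (Icc 0 a)) := by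
  have h := (E_integrable (μ := μ) ha (z := (x : ℂ)) (by simpa using hx)).re
  apply h.congr
  refine Eventually.of_forall fun t => ?_
  have : (t : ℂ) / (1 - x * t) = ((t / (1 - x * t) : ℝ) : ℂ) := by push_cast; rfl
  simp only [this]
  exact Complex.ofReal_re _

lemma den_pos {a x t : ℝ} (ha : 0 < a) (hx : x < 1 / a) (ht : t ∈ Icc 0 a) : 0 < 1 - x * t := by
  have e : a * (1 / a) = 1 := by field_simp
  rcases le_or_gt x 0 with h | h
  · nlinarith [ht.1]
  · nlinarith [ht.2]

lemma e_nonneg {μ : Measure ℝ} {a : ℝ} (ha : 0 < a) {x : ℝ}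
    (hx : x < 1 / a) : 0 ≤ efun μ a x := by
  apply setIntegral_nonneg measurableSet_Icc
  intro t ht
  exact div_nonneg ht.1 (den_pos ha hx ht).le

lemma e_mono {μ : Measure ℝ} [IsProbabilityMeasure μ] {a : ℝ} (ha : 0 < a) {x y : ℝ}
    (hxy : x ≤ y) (hy : y < 1 / a) : efun μ a x ≤ efun μ a y := by
  apply setIntegral_mono_on (e_integrable ha (hxy.trans_lt hy)) (e_integrable ha hy) measurableSet_Icc
  intro t ht
  have := den_pos ha hy ht
  have h1 := ht.1
  gcongr

lemma e_cont {μ : Measure ℝ} [IsProbabilityMeasure μ] {a : ℝ} (ha : 0 < a) {x : ℝ}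
    (hx : x < 1 / a) : ContinuousAt (efun μ a) x := by
  have h := (E_diff (μ := μ) ha (z := (x : ℂ)) (by simpa using hx)).continuousAt
  have h2 : ContinuousAt (fun x : ℝ => (Efun μ a x).re) x :=
    Complex.continuous_re.continuousAt.comp
      (ContinuousAt.comp (f := fun x : ℝ => (x : ℂ)) h Complex.continuous_ofReal.continuousAt)
  simpa [E_real] using h2

lemma psi_formula {a b : ℝ} (ha : 0 < a) (hab : a < b) {μ : Measure ℝ} (hμ : MPlus μ)
    (h3 : μ (Set.Icc 0 a) + μ {b} = 1) {z : ℂ} (hz : z.re < 1 / a) :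
    psiPlus μ z = μ.real {b} * (z * b / (1 - z * b)) + z * Efun μ a z := by
  have := hμ.1
  have hdisj : Disjoint (Icc 0 a) {b} := by
    rw [Set.disjoint_singleton_right]
    intro h
    exact absurd h.2 (not_le.2 hab)
  have hU : μ (Icc 0 a ∪ {b}) = 1 := by
    rw [measure_union hdisj (measurableSet_singleton b), h3]
  have hae : ∀ᵐ t ∂μ, t ∈ Icc 0 a ∪ {b} := by
    exact (mem_ae_iff_prob_eq_one (measurableSet_Icc.union (measurableSet_singleton b))).2 hU
  have hi : IntegrableOn (fun t : ℝ => z * (t : ℂ) / (1 - z * (t : ℂ))) (Icc 0 a) μ := by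
    have := (E_integrable (μ := μ) ha hz).const_mul z
    apply this.congr
    exact Eventually.of_forall fun t => by simp only; ring
  rw [psiPlus, ← Measure.restrict_eq_self_of_ae_mem hae,
    setIntegral_union hdisj (measurableSet_singleton b)]
  · rw [Measure.restrict_eq_self_of_ae_mem hae, integral_singleton, Efun, ← integral_const_mul,
      add_comm]
    congr 1
    congr 1
    ext t
    ring
  · exact hi
  · exact integrableOn_singleton (by simp)

lemma mu_struct {a b : ℝ} (ha : 0 < a) (hab : a < b) {μ : Measure ℝ} (hμ : MPlus μ)
    (h2 : 0 < μ {b}) (h3 : μ (Set.Icc 0 a) + μ {b} = 1)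
    (hlim : ∀ ε : ℝ, 0 < ε →
      ∀ᶠ x in nhdsWithin (1 / a) (Set.Iio (1 / a)),
        -1 - ε < (psiPlus μ ((x : ℝ) : ℂ)).re) :
    ∃ (I : Set ℝ) (Q : ℂ → ℂ) (q : ℝ → ℝ), (∀ x ∈ I, 0 < x) ∧
      (∀ x ∈ I, ∀ x', 0 < x' → x' ≤ x → x' ∈ I) ∧ 1 / b ∈ I ∧
      (∀ x, x = 0 ∨ x ∈ I → AnalyticAt ℂ Q (x : ℂ) ∧ Q x = q x ∧ 0 < q x) ∧
      (∀ x ∈ I, x ≠ 1 / b → x * q x ≠ 1) ∧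
      (∀ x ∈ I, ∀ y : ℝ, 0 < y → KPlus μ (x + y * Complex.I) =
        (x + y * Complex.I) * Q (x + y * Complex.I)) ∧
      ∀ M : ℝ, ∃ x ∈ I, M < x * (x * q x) := by
  have := hμ.1
  have hb : 0 < b := ha.trans hab
  set m := μ.real {b} with hm
  have hm0 : 0 < m := by
    rw [hm, Measure.real]; exact ENNReal.toReal_pos h2.ne' (measure_ne_top _ _)
  have hm1 : m ≤ 1 := measureReal_le_one
  have hab' : 1 / b < 1 / a := one_div_lt_one_div_of_lt ha hab
  have hb' : 0 < 1 / b := by positivity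
  set e := efun μ a with he
  set E := Efun μ a with hE
  set P : ℂ → ℂ := fun z => m * b + (1 - b * z) * E z with hP
  set D : ℂ → ℂ := fun z => z * P z + (1 - b * z) with hD
  set p : ℝ → ℝ := fun x => m * b + (1 - b * x) * e x with hp
  set d : ℝ → ℝ := fun x => x * p x + (1 - b * x) with hd
  have hPp : ∀ x : ℝ, P x = p x := by
    intro x; simp only [hP, hp, hE, he, E_real]; push_cast; ring
  have hDd : ∀ x : ℝ, D x = d x := by
    intro x; simp only [hD, hd, hPp]; push_cast; ring
  have hdf : ∀ x, d x = m - (b * x - 1) * (1 - m + x * e x) := by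
    intro x; simp only [hd, hp]; ring
  have hdlow : ∀ x, 0 ≤ x → x ≤ 1 / b → m ≤ d x := by
    intro x hx hxb
    have h1 : b * x ≤ 1 := by rw [le_div_iff₀ hb] at hxb; linarith
    have h4 : 0 ≤ e x := e_nonneg ha (by linarith)
    rw [hdf]
    nlinarith [mul_nonneg (sub_nonneg.2 h1) (add_nonneg (sub_nonneg.2 hm1) (mul_nonneg hx h4))]
  have hdanti : ∀ x x', 1 / b ≤ x' → x' ≤ x → x < 1 / a → d x ≤ d x' := by
    intro x x' h1 h4 h5
    have e1 : e x' ≤ e x := e_mono ha h4 h5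
    have e2 : 0 ≤ e x' := e_nonneg ha (by linarith)
    have h6 : 1 ≤ b * x' := by rw [div_le_iff₀ hb] at h1; linarith
    rw [hdf, hdf]
    have : (b * x' - 1) * (1 - m + x' * e x') ≤ (b * x - 1) * (1 - m + x * e x) := by
      have hx'0 : 0 < x' := by linarith
      have hx0 : 0 < x := by linarith
      have : b * x' ≤ b * x := by gcongr
      have : x' * e x' ≤ x * e x := by gcongr
      have : 0 ≤ x' * e x' := by positivity
      apply mul_le_mul <;> linarith
    linarith
  set I : Set ℝ := {x | 0 < x ∧ x < 1 / a ∧ 0 < d x} with hI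
  have hP0 : ∀ x, x = 0 ∨ x ∈ I → 0 < d x ∧ 0 < p x ∧ x < 1 / a ∧ 0 ≤ x := by
    rintro x hx
    have hx0 : 0 ≤ x := by rcases hx with rfl | h; exact le_rfl; exact h.1.le
    have hxa : x < 1 / a := by rcases hx with rfl | h; positivity; exact h.2.1
    have hdx : 0 < d x := by
      rcases hx with rfl | h
      · exact hm0.trans_le (hdlow 0 le_rfl hb'.le)
      · exact h.2.2
    refine ⟨hdx, ?_, hxa, hx0⟩
    rcases le_or_gt x (1 / b) with h | h
    · have h1 : b * x ≤ 1 := by rw [le_div_iff₀ hb] at h; linarith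
      have h4 : 0 ≤ e x := e_nonneg ha hxa
      have := mul_nonneg (sub_nonneg.2 h1) h4
      have : 0 < m * b := by positivity
      simp only [hp]; linarith
    · have h1 : 1 < b * x := by rw [div_lt_iff₀ hb] at h; linarith
      have : 0 < x * p x := by simp only [hd] at hdx; linarith
      exact pos_of_mul_pos_right this hx0
  have hxq : ∀ x, 0 < d x → x * (p x / d x) = 1 + (b * x - 1) / d x := by
    intro x hx
    field_simp
    simp only [hd]; ring
  refine ⟨I, fun z => P z / D z, fun x => p x / d x, fun x hx => hx.1, ?_, ?_, ?_, ?_, ?_, ?_⟩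
  · intro x hx x' hx'0 hx'x
    refine ⟨hx'0, hx'x.trans_lt hx.2.1, ?_⟩
    rcases le_or_gt x' (1 / b) with h | h
    · exact hm0.trans_le (hdlow x' hx'0.le h)
    · exact hx.2.2.trans_le (hdanti x x' h.le hx'x hx.2.1)
  · exact ⟨hb', hab', hm0.trans_le (hdlow _ hb'.le le_rfl)⟩
  · intro x hx
    obtain ⟨h1, h4, h5, h6⟩ := hP0 x hx
    have hEa : AnalyticAt ℂ E (x : ℂ) := E_analytic ha (by simpa using h5)
    have hPa : AnalyticAt ℂ P (x : ℂ) := by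
      simp only [hP]; fun_prop
    have hDa : AnalyticAt ℂ D (x : ℂ) := by
      simp only [hD]; fun_prop
    refine ⟨hPa.div hDa (by rw [hDd]; exact_mod_cast h1.ne'), ?_, by positivity⟩
    simp only [hPp, hDd]; push_cast; rfl
  · intro x hx hne h
    rw [hxq x hx.2.2] at h
    have h1 : (b * x - 1) / d x = 0 := by linarith
    rcases div_eq_zero_iff.1 h1 with h4 | h4
    · apply hne; field_simp; linarith
    · exact hx.2.2.ne' h4
  · intro x hx y hy
    set z : ℂ := x + y * Complex.I with hz
    have hzu : z ∈ upperHalf := xy_uh x hy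
    have hzre : z.re = x := by simp [hz]
    have hf := psi_formula ha hab hμ h3 (z := z) (by rw [hzre]; exact hx.2.1)
    have hbz : 1 - z * b ≠ 0 := den_ne z hzu b
    have hbz' : 1 - b * z ≠ 0 := by rwa [mul_comm (b : ℂ) z]
    have e1 : psiPlus μ z = z * P z / (1 - b * z) := by
      rw [hf, mul_comm z (b : ℂ)]
      simp only [hP]
      field_simp
      ring
    have e2 : 1 + psiPlus μ z = D z / (1 - b * z) := by
      rw [e1]; simp only [hD]; field_simp; ring
    have hDne : D z ≠ 0 := by
      intro h0
      apply one_add_psi_ne hμ hzu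
      rw [e2, h0, zero_div]
    rw [KPlus, e2, e1]
    field_simp
  · intro M
    have hdc : ∀ x, x < 1 / a → ContinuousAt d x := by
      intro x hx
      have : ContinuousAt e x := e_cont ha hx
      simp only [hd, hp]
      fun_prop
    have hsmall : ∀ η > 0, ∃ x, 1 / b < x ∧ x < 1 / a ∧ d x < η := by
      intro η hη
      have hbpos : 0 < b * (1 / a) := by positivity
      have ev1 := hlim (η / (b * (1 / a))) (by positivity)
      have ev2 : ∀ᶠ x in 𝓝[<] (1 / a), x ∈ Ioo (1 / b) (1 / a) := Ioo_mem_nhdsLT hab'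
      obtain ⟨x, hx1, hx2⟩ := (ev1.and ev2).exists
      refine ⟨x, hx2.1, hx2.2, ?_⟩
      have hbx : 1 < b * x := by have := hx2.1; rw [div_lt_iff₀ hb] at this; linarith
      rw [psi_formula ha hab hμ h3 (by simpa using hx2.2), E_real] at hx1
      have hr : ((μ.real {b} : ℂ) * ((x : ℂ) * b / (1 - x * b)) + x * (efun μ a x : ℂ)).re
          = m * (x * b / (1 - x * b)) + x * e x := by
        rw [← Complex.ofReal_re (m * (x * b / (1 - x * b)) + x * e x)]
        congr 1
        push_cast
        rfl
      rw [hr] at hx1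
      have hne : 1 - x * b ≠ 0 := by nlinarith
      have e1 : d x = -(b * x - 1) * (1 + (m * (x * b / (1 - x * b)) + x * e x)) := by
        rw [hdf]
        have hw : x * b / (1 - x * b) * (1 - x * b) = x * b := div_mul_cancel₀ _ hne
        linear_combination (-m) * hw
      rw [e1]
      set ps := m * (x * b / (1 - x * b)) + x * e x
      have k1 : -(1 + ps) < η / (b * (1 / a)) := by linarith
      have k2 : b * x - 1 < b * (1 / a) := by
        have := mul_lt_mul_of_pos_left hx2.2 hb
        linarith
      calc -(b * x - 1) * (1 + ps) = (b * x - 1) * (-(1 + ps)) := by ring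
        _ < (b * x - 1) * (η / (b * (1 / a))) := by
          apply mul_lt_mul_of_pos_left k1; linarith
        _ ≤ (b * (1 / a)) * (η / (b * (1 / a))) := by gcongr
        _ = η := by field_simp
    have hd1 : d (1 / b) = m := by rw [hdf]; field_simp; ring
    have hivt : ∀ η, 0 < η → η < m → ∃ x, 1 / b < x ∧ x < 1 / a ∧ d x = η := by
      intro η h0 h1
      obtain ⟨x1, hx1, hx2, hx3⟩ := hsmall η h0
      have hc : ContinuousOn d (Icc (1 / b) x1) :=
        fun x hx => (hdc x (hx.2.trans_lt hx2)).continuousWithinAt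
      obtain ⟨x, hx, hxe⟩ := intermediate_value_Icc' hx1.le hc ⟨hx3.le, by rw [hd1]; exact h1.le⟩
      refine ⟨x, lt_of_le_of_ne hx.1 ?_, hx.2.trans_lt hx2, hxe⟩
      rintro rfl
      rw [hd1] at hxe; linarith
    obtain ⟨xs, hs1, hs2, hs3⟩ := hivt (m / 2) (by linarith) (by linarith)
    have hbs : 0 < b * xs - 1 := by rw [div_lt_iff₀ hb] at hs1; linarith
    set η := min (m / 4) (xs * (b * xs - 1) / (|M| + 1)) with hη
    have hxs0 : 0 < xs := hb'.trans hs1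
    have hη0 : 0 < η := by positivity
    have hη1 : η ≤ m / 4 := min_le_left _ _
    obtain ⟨x, hx1, hx2, hx3⟩ := hivt η hη0 (by linarith)
    have hxxs : xs ≤ x := by
      by_contra! h
      have := hdanti xs x hx1.le h.le hs2
      linarith
    have hx0 : 0 < x := hb'.trans hx1
    refine ⟨x, ⟨hx0, hx2, by rw [hx3]; exact hη0⟩, ?_⟩
    rw [hxq x (by rw [hx3]; exact hη0), hx3]
    have k : (|M| + 1) ≤ xs * (b * xs - 1) / η := by
      rw [le_div_iff₀ hη0, mul_comm, ← le_div_iff₀ (by positivity)]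
      exact min_le_right _ _
    have k2 : xs * (b * xs - 1) / η ≤ x * ((b * x - 1) / η) := by
      rw [← mul_div_assoc]; gcongr
    have := le_abs_self M
    linarith

lemma surj_of {Z : ℂ → ℂ} (hZ : kreinClass Z) (hm : ∀ z ∈ upperHalf, Z z ∈ upperHalf)
    {I : Set ℝ} (hI0 : ∀ x ∈ I, 0 < x)
    (hIl : ∀ x ∈ I, ∀ x', 0 < x' → x' ≤ x → x' ∈ I) (harg : ArgBound Z I) {g : ℝ → ℝ}
    (hg : ∀ x ∈ I, Tendsto (fun y : ℝ => Z (x + y * Complex.I)) (𝓝[>] 0)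
        (𝓝 ((Real.exp (g x) : ℝ) : ℂ)))
    (hgc : ∀ x0 X, 0 < x0 → X ∈ I → ContinuousOn g (Icc x0 X))
    (hub : ∀ M : ℝ, ∃ x ∈ I, M < Real.exp (g x)) :
    ∀ s > 0, ∃ x ∈ I, Real.exp (g x) = s := by
  intro s hs
  obtain ⟨X, hX, hXs⟩ := hub s
  obtain ⟨x0, h0, h1, h2⟩ := bdry_zero hZ hm hI0 hIl harg hg hX hs
  have hc : ContinuousOn (fun x => Real.exp (g x)) (Icc x0 X) := (hgc x0 X h0 hX).rexp
  obtain ⟨x, hx, hxe⟩ := intermediate_value_Icc h1 hc ⟨h2.le, hXs.le⟩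
  exact ⟨x, hIl X hX x (h0.trans_le hx.1) hx.2, hxe⟩

lemma argBound_of {Z W : ℂ → ℂ} (hZ : ∀ z ∈ upperHalf, Z z ∈ upperHalf)
    (hW : ∀ z ∈ upperHalf, W z ∈ upperHalf) {μ : Measure ℝ} (hμ : MPlus μ)
    (h : ∀ z ∈ upperHalf, Z z * W z = z * KPlus μ z)
    {I : Set ℝ} {Q : ℂ → ℂ} {q : ℝ → ℝ} (hI0 : ∀ x ∈ I, 0 < x)
    (hIl : ∀ x ∈ I, ∀ x', 0 < x' → x' ≤ x → x' ∈ I)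
    (hQ : ∀ x, x = 0 ∨ x ∈ I → AnalyticAt ℂ Q (x : ℂ) ∧ Q x = q x ∧ 0 < q x)
    (hKQ : ∀ x ∈ I, ∀ y : ℝ, 0 < y → KPlus μ (x + y * Complex.I) =
        (x + y * Complex.I) * Q (x + y * Complex.I)) : ArgBound Z I := by
  intro X hX
  have hX0 := hI0 X hX
  obtain ⟨C, hC, c, hc, δ, hδ, hδ1, hb⟩ := zQ_bounds (q := q) hX0 (fun x hx => hQ x (by
    rcases eq_or_lt_of_le hx.1 with h | h
    · exact Or.inl h.symm
    · exact Or.inr (hIl X hX x h hx.2)))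
  refine ⟨1 + C / c, by positivity, δ, hδ, hδ1, ?_⟩
  intro x y hx hxX hy hyd
  have hxI := hIl X hX x hx hxX
  have hzu := xy_uh x hy
  have hs := arg_sum (hZ _ hzu) (hW _ hzu) hzu (K_uh hμ hzu) (h _ hzu)
  have hw := (arg_uh (hW _ hzu)).1
  have h1 : ((x : ℂ) + y * Complex.I).arg ≤ y / x := by
    have := arg_le_div (z := (x : ℂ) + y * Complex.I) (by simpa using hx) (by simpa using hy.le)
    simpa using this
  have h2 : (KPlus μ (x + y * Complex.I)).arg ≤ C / c * (y / x) := by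
    obtain ⟨b1, b2⟩ := hb x y hx hxX hy hyd
    have hk : 0 < (KPlus μ (x + y * Complex.I)).im := K_uh hμ hzu
    rw [← hKQ x hxI y hy] at b1 b2
    have b3 : 0 < c * x := by positivity
    refine (arg_le_div (b3.trans_le b2) hk.le).trans ?_
    calc _ ≤ (C * y) / (c * x) := by gcongr
      _ = C / c * (y / x) := by field_simp
  linarith

lemma final_half {ν μ : Measure ℝ} (hν : MPlus ν) {Z : ℂ → ℂ} (hZ : kreinClass Z)
    (hm : ∀ z ∈ upperHalf, Z z ∈ upperHalf)
    (hK : ∀ z ∈ upperHalf, KPlus ν (Z z) = KPlus μ z) {xb : ℝ}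
    {I : Set ℝ} {Q : ℂ → ℂ} {q : ℝ → ℝ} {g : ℝ → ℝ} (hI0 : ∀ x ∈ I, 0 < x)
    (hIl : ∀ x ∈ I, ∀ x', 0 < x' → x' ≤ x → x' ∈ I)
    (hQ : ∀ x, x = 0 ∨ x ∈ I → AnalyticAt ℂ Q (x : ℂ) ∧ Q x = q x ∧ 0 < q x)
    (hq1 : ∀ x ∈ I, x ≠ xb → x * q x ≠ 1)
    (hKQ : ∀ x ∈ I, ∀ y : ℝ, 0 < y → KPlus μ (x + y * Complex.I) =
        (x + y * Complex.I) * Q (x + y * Complex.I))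
    (hKt : ∀ x ∈ I, Tendsto (fun y : ℝ => KPlus μ (x + y * Complex.I)) (𝓝[>] 0)
      (𝓝 ((x * q x : ℝ) : ℂ)))
    (harg : ArgBound Z I)
    (hg : ∀ x ∈ I, Tendsto (fun y : ℝ => Z (x + y * Complex.I)) (𝓝[>] 0)
        (𝓝 ((Real.exp (g x) : ℝ) : ℂ)))
    (hgc : ∀ x0 X, 0 < x0 → X ∈ I → ContinuousOn g (Icc x0 X))
    (hub : ∀ M : ℝ, ∃ x ∈ I, M < Real.exp (g x)) :
    ∃ c : ℝ, 0 < c ∧ ν = Measure.dirac c := by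
  have hsub : upperHalf ⊆ kreinDomain := fun z hz => Or.inl (ne_of_gt hz)
  refine ⟨(Real.exp (g xb))⁻¹, by positivity, ?_⟩
  refine core_dirac_s19 hν (hZ.1.mono hsub) hm hK hg (surj_of hZ hm hI0 hIl harg hg hgc hub) ?_
  intro x hx
  refine ⟨_, hKt x hx, fun hne => by exact_mod_cast hq1 x hx hne, ?_⟩
  obtain ⟨C, hC, c, hc, δ, hδ, hδ1, hb⟩ := zQ_bounds (q := q) (hI0 x hx) (fun x' hx' => hQ x' (by
    rcases eq_or_lt_of_le hx'.1 with h | h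
    · exact Or.inl h.symm
    · exact Or.inr (hIl x hx x' h hx'.2)))
  refine ⟨C, ?_⟩
  have hx0 := hI0 x hx
  have : Ioc 0 (δ * x) ∈ 𝓝[>] (0 : ℝ) := Ioc_mem_nhdsGT (by positivity)
  filter_upwards [this] with y hy
  rw [hKQ x hx y hy.1]
  exact (hb x y hx0 le_rfl hy.1 hy.2).1

/-- Theorem 8.2: a measure in ℳ₊ with mass on (0,a], an atom at b, and
lim_{x ↑ 1/a} ψ_μ(x) ≥ −1 is indecomposable for multiplicative free convolution
on [0,∞). -/
theorem indecomposable_multiplicative_halfline (a b : ℝ) (ha : 0 < a) (hab : a < b)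
    (μ : Measure ℝ) (hμ : MPlus μ)
    (h1 : 0 < μ (Set.Ioc 0 a)) (h2 : 0 < μ {b})
    (h3 : μ (Set.Icc 0 a) + μ {b} = 1)
    (hlim : ∀ ε : ℝ, 0 < ε →
      ∀ᶠ x in nhdsWithin (1 / a) (Set.Iio (1 / a)),
        -1 - ε < (psiPlus μ ((x : ℝ) : ℂ)).re) :
    ∀ μ₁ μ₂ : Measure ℝ, MPlus μ₁ → MPlus μ₂ →
      ∀ Z₁ Z₂ : ℂ → ℂ, kreinClass Z₁ → kreinClass Z₂ →
        (∀ z ∈ upperHalf,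
          Z₁ z * Z₂ z = z * KPlus μ₁ (Z₁ z) ∧
          KPlus μ₁ (Z₁ z) = KPlus μ₂ (Z₂ z) ∧
          KPlus μ₁ (Z₁ z) = KPlus μ z) →
        ∃ c : ℝ, 0 < c ∧ (μ₁ = Measure.dirac c ∨ μ₂ = Measure.dirac c) := by
  intro μ₁ μ₂ hμ₁ hμ₂ Z₁ Z₂ hZ₁ hZ₂ h
  obtain ⟨I, Q, q, hI0, hIl, hbI, hQ, hq1, hKQ, hub⟩ := mu_struct ha hab hμ h2 h3 hlim
  have hK1 : ∀ z ∈ upperHalf, KPlus μ₁ (Z₁ z) = KPlus μ z := fun z hz => (h z hz).2.2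
  have hK2 : ∀ z ∈ upperHalf, KPlus μ₂ (Z₂ z) = KPlus μ z :=
    fun z hz => (h z hz).2.1.symm.trans (h z hz).2.2
  have hprod : ∀ z ∈ upperHalf, Z₁ z * Z₂ z = z * KPlus μ z :=
    fun z hz => by rw [(h z hz).1, hK1 z hz]
  have hprod' : ∀ z ∈ upperHalf, Z₂ z * Z₁ z = z * KPlus μ z :=
    fun z hz => by rw [mul_comm, hprod z hz]
  have hne : Z₁ Complex.I * Z₂ Complex.I ≠ 0 := by
    have hi : Complex.I ∈ upperHalf := by simp [upperHalf]
    rw [hprod _ hi]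
    exact mul_ne_zero (ne_zero_uh hi) (ne_zero_uh (K_uh hμ hi))
  have hi : Complex.I ∈ upperHalf := by simp [upperHalf]
  have hm1 := krein_maps hZ₁ ⟨Complex.I, hi, left_ne_zero_of_mul hne⟩
  have hm2 := krein_maps hZ₂ ⟨Complex.I, hi, right_ne_zero_of_mul hne⟩
  have ha1 := argBound_of hm1 hm2 hμ hprod hI0 hIl hQ hKQ
  have ha2 := argBound_of hm2 hm1 hμ hprod' hI0 hIl hQ hKQ
  have hsub : upperHalf ⊆ kreinDomain := fun z hz => Or.inl (ne_of_gt hz)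
  obtain ⟨g1, hg1, hgc1⟩ := bdry_global (hZ₁.1.mono hsub) hm1 hI0 hIl ha1
  obtain ⟨g2, hg2, hgc2⟩ := bdry_global (hZ₂.1.mono hsub) hm2 hI0 hIl ha2
  have hev : ∀ᶠ y : ℝ in 𝓝[>] 0, 0 < y := self_mem_nhdsWithin
  have hKt : ∀ x ∈ I, Tendsto (fun y : ℝ => KPlus μ (x + y * Complex.I)) (𝓝[>] 0)
      (𝓝 ((x * q x : ℝ) : ℂ)) := by
    intro x hx
    obtain ⟨q1, q2, -⟩ := hQ x (Or.inr hx)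
    have t1 := (tendsto_vert x).mul (q1.continuousAt.tendsto.comp (tendsto_vert x))
    rw [q2, ← Complex.ofReal_mul] at t1
    refine t1.congr' ?_
    filter_upwards [hev] with y hy
    rw [hKQ x hx y hy]
    rfl
  have hgg : ∀ x ∈ I, Real.exp (g1 x) * Real.exp (g2 x) = x * (x * q x) := by
    intro x hx
    have t1 := (hg1 x hx).mul (hg2 x hx)
    have t2 := (tendsto_vert x).mul (hKt x hx)
    have t3 := t2.congr' (f₂ := fun y : ℝ => Z₁ (x + y * Complex.I) * Z₂ (x + y * Complex.I)) (by
      filter_upwards [hev] with y hy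
      rw [hprod _ (xy_uh x hy)])
    have := tendsto_nhds_unique t1 t3
    exact_mod_cast this
  by_cases hb1 : ∀ M : ℝ, ∃ x ∈ I, M < Real.exp (g1 x)
  · obtain ⟨c, hc, hd⟩ := final_half hμ₁ hZ₁ hm1 hK1 hI0 hIl hQ hq1 hKQ hKt ha1 hg1 hgc1 hb1
    exact ⟨c, hc, Or.inl hd⟩
  · have hb2 : ∀ M : ℝ, ∃ x ∈ I, M < Real.exp (g2 x) := by
      push Not at hb1
      obtain ⟨M1, hM1⟩ := hb1
      intro M
      by_contra! hcon
      obtain ⟨x, hx, hxM⟩ := hub (M1 * M)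
      rw [← hgg x hx] at hxM
      have e1 := Real.exp_pos (g1 x)
      have e2 := Real.exp_pos (g2 x)
      have := mul_le_mul (hM1 x hx) (hcon x hx) e2.le (e1.le.trans (hM1 x hx))
      linarith
    obtain ⟨c, hc, hd⟩ := final_half hμ₂ hZ₂ hm2 hK2 hI0 hIl hQ hq1 hKQ hKt ha2 hg2 hgc2 hb2
    exact ⟨c, hc, Or.inr hd⟩
end
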